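/- arXiv:2108.06724 — 2 statements merged into one kernel-verified Lean document; each statement's English description precedes it below -/
import Mathlib

section
/- Let f : G → G be a graph map and ⟨x,y⟩ ∈ G×G with x ≠ y. Then ⟨x,y⟩ is an NS-pair if and only if x and y are non-separable and there exists z ∈ G such that ω_f(z) is a solenoid and x, y ∈ ω_f(z). -/
open Set Filter Topology

/-- An arc in `X` with endpoints `a` and `b`: the image of a continuous injection
of `[0,1]` sending `0` to `a` and `1` to `b`. -/
def IsArcWithEnds {X : Type*} [TopologicalSpace X] (A : Set X) (a b : X) : Prop :=
  ∃ φ : Set.Icc (0:ℝ) 1 → X, Continuous φ ∧ Function.Injective φ ∧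
    Set.range φ = A ∧ φ ⟨0, by norm_num⟩ = a ∧ φ ⟨1, by norm_num⟩ = b

/-- A topological graph: a compact connected (metrizable) space which is a union of
finitely many arcs, any two of which are either disjoint or intersect in exactly one
common endpoint. -/
def IsTopGraph (X : Type*) [TopologicalSpace X] : Prop :=
  CompactSpace X ∧ ConnectedSpace X ∧
  ∃ (n : ℕ) (A : Fin n → Set X) (a b : Fin n → X),
    (∀ i, IsArcWithEnds (A i) (a i) (b i)) ∧
    (⋃ i, A i) = Set.univ ∧
    ∀ i j, i ≠ j →
      A i ∩ A j = ∅ ∨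
      ∃ p, A i ∩ A j = {p} ∧ p ∈ ({a i, b i} : Set X) ∧ p ∈ ({a j, b j} : Set X)

/-- A subgraph of `G`: a closed connected subset which is itself a topological graph. -/
def IsSubgraph {G : Type*} [TopologicalSpace G] (K : Set G) : Prop :=
  IsClosed K ∧ IsConnected K ∧ IsTopGraph ↥K

/-- A periodic subgraph with period `k`: `K, f(K), …, f^{k−1}(K)` are pairwise disjoint
and `f^k(K) = K`. -/
def IsPeriodicSubgraph {G : Type*} [TopologicalSpace G] (f : G → G) (K : Set G) (k : ℕ) :
    Prop :=
  IsSubgraph K ∧ 0 < k ∧ f^[k] '' K = K ∧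
    ∀ i j, i < k → j < k → i ≠ j → Disjoint (f^[i] '' K) (f^[j] '' K)

/-- A cycle of graphs with period `k`: the orbit `⋃_{i<k} f^i(K)` of a periodic
subgraph `K` with period `k`. -/
def IsCycleOfGraphs {G : Type*} [TopologicalSpace G] (f : G → G) (X : Set G) (k : ℕ) :
    Prop :=
  ∃ K, IsPeriodicSubgraph f K k ∧ X = ⋃ i ∈ Finset.range k, f^[i] '' K

/-- The ω-limit set of `x` under `f`. -/
def omegaSet {G : Type*} [TopologicalSpace G] (f : G → G) (x : G) : Set G :=
  ⋂ n : ℕ, closure ((fun m => f^[m] x) '' Set.Ici n)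

/-- `ω(f) = ⋃_{x} ω_f(x)`. -/
def omegaUnion {G : Type*} [TopologicalSpace G] (f : G → G) : Set G :=
  ⋃ x, omegaSet f x

/-- A set `W` is a solenoid for `f` if it is infinite and is contained in cycles of
graphs of arbitrarily large periods. -/
def IsSolenoid {G : Type*} [TopologicalSpace G] (f : G → G) (W : Set G) : Prop :=
  W.Infinite ∧ ∀ n : ℕ, ∃ X k, n ≤ k ∧ IsCycleOfGraphs f X k ∧ W ⊆ X

/-- Two points are separable if they belong to two disjoint periodic subgraphs. -/
def SeparablePoints {G : Type*} [TopologicalSpace G] (f : G → G) (x y : G) : Prop :=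
  ∃ I J kI kJ, IsPeriodicSubgraph f I kI ∧ IsPeriodicSubgraph f J kJ ∧
    Disjoint I J ∧ x ∈ I ∧ y ∈ J

/-- An NS-pair: a pair of distinct points of `ω(f)` contained in a nested sequence of
periodic subgraphs whose periods tend to infinity. -/
def IsNSPair {G : Type*} [TopologicalSpace G] (f : G → G) (x y : G) : Prop :=
  x ≠ y ∧ x ∈ omegaUnion f ∧ y ∈ omegaUnion f ∧
  ∃ (J : ℕ → Set G) (m : ℕ → ℕ),
    (∀ n, IsPeriodicSubgraph f (J n) (m n)) ∧
    (∀ n, J (n + 1) ⊆ J n) ∧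
    Filter.Tendsto m Filter.atTop Filter.atTop ∧
    ∀ n, x ∈ J n ∧ y ∈ J n

/-- The pair `⟨x,y⟩` is proximal. -/
def Proximal {G : Type*} [PseudoMetricSpace G] (f : G → G) (x y : G) : Prop :=
  ∀ ε > (0 : ℝ), ∀ N : ℕ, ∃ n ≥ N, dist (f^[n] x) (f^[n] y) < ε

/-- The pair `⟨x,y⟩` is asymptotic. -/
def Asymptotic {G : Type*} [PseudoMetricSpace G] (f : G → G) (x y : G) : Prop :=
  Filter.Tendsto (fun n => dist (f^[n] x) (f^[n] y)) Filter.atTop (nhds 0)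

/-- A scrambled pair is proximal but not asymptotic. -/
def ScrambledPair {G : Type*} [PseudoMetricSpace G] (f : G → G) (x y : G) : Prop :=
  Proximal f x y ∧ ¬ Asymptotic f x y

/-- Li–Yorke chaos: existence of an uncountable scrambled set. -/
def LiYorkeChaotic {G : Type*} [PseudoMetricSpace G] (f : G → G) : Prop :=
  ∃ S : Set G, ¬ S.Countable ∧ ∀ x ∈ S, ∀ y ∈ S, x ≠ y → ScrambledPair f x y

/-- `I ⊆ ℕ` is an independence set for the pair of sets `{A, B}`. -/
def IsIndepSet {G : Type*} (f : G → G) (A B : Set G) (I : Set ℕ) : Prop :=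
  ∀ J : Finset ℕ, ↑J ⊆ I → J.Nonempty → ∀ S : ℕ → Bool,
    (⋂ i ∈ J, f^[i] ⁻¹' (if S i then A else B)).Nonempty

/-- An IN-pair: every pair of neighborhoods has arbitrarily large finite
independence sets. -/
def IsINPair {G : Type*} [TopologicalSpace G] (f : G → G) (x y : G) : Prop :=
  ∀ U V : Set G, U ∈ nhds x → V ∈ nhds y →
    ∀ n : ℕ, ∃ I : Finset ℕ, n ≤ I.card ∧ IsIndepSet f U V ↑I

/-- An IT-pair: every pair of neighborhoods has an infinite independence set. -/
def IsITPair {G : Type*} [TopologicalSpace G] (f : G → G) (x y : G) : Prop :=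
  ∀ U V : Set G, U ∈ nhds x → V ∈ nhds y →
    ∃ I : Set ℕ, I.Infinite ∧ IsIndepSet f U V I

/-- The set of periodic points of `f`. -/
def PerPts {G : Type*} (f : G → G) : Set G :=
  {p | ∃ n ≥ 1, f^[n] p = p}

/-- Edge parametrizations of a topological graph: the `i`-th edge is `Φ i '' Icc 0 1`. -/
structure IsEdgeSystem {G : Type*} [TopologicalSpace G] {n : ℕ} (Φ : Fin n → ℝ → G) : Prop where
  cont : ∀ i, Continuous (Φ i)
  inj : ∀ i, InjOn (Φ i) (Icc 0 1)
  cover : ∀ q, ∃ i, ∃ t ∈ Icc (0 : ℝ) 1, Φ i t = q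
  eq_zero_or_one : ∀ i j, i ≠ j → ∀ s ∈ Icc (0 : ℝ) 1, ∀ t ∈ Icc (0 : ℝ) 1,
    Φ i s = Φ j t → s = 0 ∨ s = 1
  uniq : ∀ i j, i ≠ j → ∀ s ∈ Icc (0 : ℝ) 1, ∀ t ∈ Icc (0 : ℝ) 1,
    ∀ s' ∈ Icc (0 : ℝ) 1, ∀ t' ∈ Icc (0 : ℝ) 1,
    Φ i s = Φ j t → Φ i s' = Φ j t' → Φ i s = Φ i s'

theorem IsTopGraph.exists_isEdgeSystem {G : Type*} [TopologicalSpace G] (hG : IsTopGraph G) :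
    ∃ (n : ℕ) (Φ : Fin n → ℝ → G), IsEdgeSystem Φ := by
  obtain ⟨-, -, n, A, a, b, hA, hU, hI⟩ := hG
  choose φ hc hi hr h0 h1 using hA
  have key : ∀ i, ∀ t (ht : t ∈ Icc (0 : ℝ) 1),
      (φ i ∘ projIcc 0 1 zero_le_one) t = φ i ⟨t, ht⟩ := fun i t ht => by
    simp [projIcc_of_mem _ ht]
  have mem : ∀ i, ∀ t ∈ Icc (0 : ℝ) 1, (φ i ∘ projIcc 0 1 zero_le_one) t ∈ A i := fun i t ht => by
    rw [← hr i]; exact mem_range_self _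
  refine ⟨n, fun i => φ i ∘ projIcc 0 1 zero_le_one, fun i => (hc i).comp continuous_projIcc,
    fun i s hs t ht h => ?_, fun q => ?_, fun i j hij s hs t ht h => ?_,
    fun i j hij s hs t ht s' hs' t' ht' h h' => ?_⟩
  · rw [key i s hs, key i t ht] at h
    simpa using hi i h
  · have : q ∈ ⋃ i, A i := hU ▸ mem_univ q
    obtain ⟨i, hq⟩ := mem_iUnion.1 this
    rw [← hr i] at hq
    obtain ⟨t, rfl⟩ := hq
    exact ⟨i, t, t.2, key i t t.2⟩
  · have hm : (φ i ∘ projIcc 0 1 zero_le_one) s ∈ A i ∩ A j := ⟨mem i s hs, h ▸ mem j t ht⟩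
    rcases hI i j hij with he | ⟨p, he, hp, -⟩
    · simp [he] at hm
    · rw [he, mem_singleton_iff] at hm
      rw [← hm, key i s hs, ← h0, ← h1] at hp
      rcases hp with hp | hp
      · exact Or.inl (congrArg Subtype.val (hi i hp))
      · exact Or.inr (congrArg Subtype.val (hi i hp))
  · have hm : (φ i ∘ projIcc 0 1 zero_le_one) s ∈ A i ∩ A j := ⟨mem i s hs, h ▸ mem j t ht⟩
    have hm' : (φ i ∘ projIcc 0 1 zero_le_one) s' ∈ A i ∩ A j := ⟨mem i s' hs', h' ▸ mem j t' ht'⟩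
    rcases hI i j hij with he | ⟨p, he, -⟩
    · simp [he] at hm
    · rw [he, mem_singleton_iff] at hm hm'
      exact hm.trans hm'.symm

/-- A preconnected set meeting `s` but not its frontier is contained in `s`. -/
theorem IsPreconnected.subset_of_disjoint_frontier {α : Type*} [TopologicalSpace α] {c s : Set α}
    (hc : IsPreconnected c) (h : (c ∩ s).Nonempty) (hd : Disjoint c (frontier s)) : c ⊆ s := by
  have hcov : c ⊆ interior s ∪ (closure s)ᶜ := fun p hp => by
    by_contra hn
    simp only [mem_union, mem_compl_iff, not_or, not_not] at hn
    exact disjoint_left.1 hd hp ⟨hn.2, hn.1⟩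
  refine (hc.subset_left_of_subset_union isOpen_interior isClosed_closure.isOpen_compl ?_ hcov
    ?_).trans interior_subset
  · exact disjoint_compl_right_iff_subset.2 interior_subset_closure
  · obtain ⟨p, hp, hps⟩ := h
    exact ⟨p, hp, (hcov hp).resolve_right fun h => h (subset_closure hps)⟩

namespace IsEdgeSystem

/-- The set of endpoints of the edges. -/
def vertices {G : Type*} {n : ℕ} (Φ : Fin n → ℝ → G) : Set G :=
  range (fun i => Φ i 0) ∪ range (fun i => Φ i 1)

theorem finite_vertices {G : Type*} {n : ℕ} {Φ : Fin n → ℝ → G} : (vertices Φ).Finite :=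
  (finite_range _).union (finite_range _)

variable {G : Type*} [TopologicalSpace G] [T2Space G] {n : ℕ} {Φ : Fin n → ℝ → G}

theorem isClosed_edge (h : IsEdgeSystem Φ) (i : Fin n) : IsClosed (Φ i '' Icc 0 1) :=
  (isCompact_Icc.image (h.cont i)).isClosed

theorem isOpen_image (h : IsEdgeSystem Φ) (i : Fin n) {U : Set ℝ} (hU : IsOpen U)
    (hU1 : U ⊆ Ioo 0 1) : IsOpen (Φ i '' U) := by
  have hc : (Φ i '' U)ᶜ = Φ i '' (Icc 0 1 \ U) ∪ ⋃ j ∈ {j | j ≠ i}, Φ j '' Icc 0 1 := by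
    ext q
    constructor
    · intro hq
      obtain ⟨j, t, ht, rfl⟩ := h.cover q
      by_cases hj : j = i
      · subst hj
        exact Or.inl ⟨t, ⟨ht, fun htU => hq ⟨t, htU, rfl⟩⟩, rfl⟩
      · exact Or.inr (mem_biUnion (x := j) hj ⟨t, ht, rfl⟩)
    · rintro hq ⟨u, hu, rfl⟩
      have hu1 := hU1 hu
      rcases hq with ⟨t, ht, he⟩ | hq
      · exact ht.2 (h.inj i ht.1 (Ioo_subset_Icc_self hu1) he ▸ hu)
      · obtain ⟨j, hj, t, ht, he⟩ := mem_iUnion₂.1 hq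
        rcases h.eq_zero_or_one i j (Ne.symm hj) u (Ioo_subset_Icc_self hu1) t ht he.symm with h0 | h0
        · exact hu1.1.ne' h0
        · exact hu1.2.ne h0
  rw [← isClosed_compl_iff, hc]
  refine IsClosed.union ((isCompact_Icc.diff hU).image (h.cont i)).isClosed ?_
  exact (toFinite _).isClosed_biUnion fun j _ => h.isClosed_edge j

theorem exists_subset_edge (h : IsEdgeSystem Φ) {C : Set G} (hC : IsConnected C)
    (hV : Disjoint C (vertices Φ)) : ∃ i, C ⊆ Φ i '' Ioo 0 1 := by
  obtain ⟨c, hc⟩ := hC.nonempty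
  obtain ⟨i, t, ht, rfl⟩ := h.cover c
  have hIoo : ∀ t ∈ Icc (0 : ℝ) 1, Φ i t ∈ C → t ∈ Ioo (0 : ℝ) 1 := fun t ht htC => by
    refine ⟨ht.1.lt_of_ne' fun h0 => ?_, ht.2.lt_of_ne fun h0 => ?_⟩
    · exact disjoint_left.1 hV htC (Or.inl ⟨i, by simp [h0]⟩)
    · exact disjoint_left.1 hV htC (Or.inr ⟨i, by simp [h0]⟩)
  have hsub : C ⊆ Φ i '' Icc 0 1 := by
    refine hC.isPreconnected.subset_of_disjoint_frontier ⟨_, hc, t, ht, rfl⟩ ?_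
    rw [disjoint_left]
    rintro q hq hqf
    obtain ⟨s, hs, rfl⟩ := (h.isClosed_edge i).frontier_subset hqf
    exact hqf.2 (interior_maximal (image_mono Ioo_subset_Icc_self)
      (h.isOpen_image i isOpen_Ioo Subset.rfl) ⟨s, hIoo s hs hq, rfl⟩)
  refine ⟨i, fun q hq => ?_⟩
  obtain ⟨s, hs, rfl⟩ := hsub hq
  exact ⟨s, hIoo s hs hq, rfl⟩

theorem Icc_subset_preimage (h : IsEdgeSystem Φ) {i : Fin n} {C : Set G} (hC : IsPreconnected C)
    (hsub : C ⊆ Φ i '' Icc 0 1) {u v : ℝ} (hu : u ∈ Icc (0 : ℝ) 1) (hv : v ∈ Icc (0 : ℝ) 1)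
    (huC : Φ i u ∈ C) (hvC : Φ i v ∈ C) : Icc u v ⊆ Φ i ⁻¹' C := by
  set ψ : Icc (0 : ℝ) 1 → G := fun t => Φ i t
  have hψ : Continuous ψ := (h.cont i).comp continuous_subtype_val
  have hinj : Function.Injective ψ := fun s t hst => Subtype.ext (h.inj i s.2 t.2 hst)
  have hpre : IsPreconnected (ψ ⁻¹' C) := by
    refine hC.preimage_of_isClosedMap hinj hψ.isClosedMap fun q hq => ?_
    obtain ⟨s, hs, rfl⟩ := hsub hq
    exact ⟨⟨s, hs⟩, rfl⟩
  intro w hw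
  have hw1 : w ∈ Icc (0 : ℝ) 1 := ⟨hu.1.trans hw.1, hw.2.trans hv.2⟩
  have hmem : (⟨w, hw1⟩ : Icc (0 : ℝ) 1) ∈ Icc (⟨u, hu⟩ : Icc (0 : ℝ) 1) ⟨v, hv⟩ := hw
  exact hpre.ordConnected.out (x := ⟨u, hu⟩) huC (y := ⟨v, hv⟩) hvC hmem

/-- A connected set meeting an edge between two of its missing points stays between them. -/
theorem subset_image_Ioo (h : IsEdgeSystem Φ) {i : Fin n} {C : Set G} (hC : IsPreconnected C)
    {p q : ℝ} (hp : 0 < p) (hq : q < 1) (hpC : Φ i p ∉ C) (hqC : Φ i q ∉ C)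
    (hne : (C ∩ Φ i '' Ioo p q).Nonempty) : C ⊆ Φ i '' Ioo p q := by
  refine hC.subset_of_disjoint_frontier hne (disjoint_left.2 fun c hc hcf => ?_)
  have hcl : c ∈ Φ i '' Icc p q := closure_minimal (image_mono Ioo_subset_Icc_self)
    (isCompact_Icc.image (h.cont i)).isClosed hcf.1
  obtain ⟨t, ht, rfl⟩ := hcl
  have hpt : p ≠ t := fun e => hpC (e ▸ hc)
  have hqt : q ≠ t := fun e => hqC (e ▸ hc)
  have hO := h.isOpen_image i (isOpen_Ioo (a := p) (b := q)) (Ioo_subset_Ioo hp.le hq.le)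
  exact hcf.2 (hO.interior_eq.symm ▸ ⟨t, ⟨ht.1.lt_of_ne hpt, ht.2.lt_of_ne hqt.symm⟩, rfl⟩)

theorem finite_frontier (h : IsEdgeSystem Φ) {K : Set G} (hK : IsClosed K)
    (hC : IsPreconnected K) : (frontier K).Finite := by
  have hfin : ∀ i, {t ∈ Ioo (0 : ℝ) 1 | Φ i t ∈ frontier K}.Finite := fun i => by
    by_contra hinf
    obtain ⟨T, hT, hcard⟩ := Set.Infinite.exists_subset_card_eq hinf 5
    set e := T.orderEmbOfFin hcard
    have he : ∀ k, e k ∈ Ioo (0 : ℝ) 1 ∧ Φ i (e k) ∈ frontier K := fun k =>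
      hT (T.orderEmbOfFin_mem hcard k)
    have hlt : ∀ {k l}, k < l → e k < e l := fun hkl => e.lt_iff_lt.2 hkl
    have gap : ∀ k l m, k < l → l < m → ∃ p ∈ Ioo (e k) (e m), Φ i p ∉ K := fun k l m hkl hlm => by
      by_contra! hall
      refine (he l).2.2 (interior_maximal (image_subset_iff.2 hall)
        (h.isOpen_image i isOpen_Ioo (Ioo_subset_Ioo (he k).1.1.le (he m).1.2.le))
        ⟨e l, ⟨hlt hkl, hlt hlm⟩, rfl⟩)
    obtain ⟨p, hp, hpK⟩ := gap 0 1 2 (by decide) (by decide)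
    obtain ⟨q, hq, hqK⟩ := gap 2 3 4 (by decide) (by decide)
    have hsub := h.subset_image_Ioo hC ((he 0).1.1.trans hp.1) (hq.2.trans (he 4).1.2) hpK hqK
      ⟨Φ i (e 2), hK.frontier_subset (he 2).2, e 2, ⟨hp.2, hq.1⟩, rfl⟩
    obtain ⟨t, ht, hte⟩ := hsub (hK.frontier_subset (he 0).2)
    have : t = e 0 := h.inj i ⟨((he 0).1.1.trans (hp.1.trans ht.1)).le,
      (ht.2.trans (hq.2.trans (he 4).1.2)).le⟩ (Ioo_subset_Icc_self (he 0).1) hte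
    exact (this ▸ ht.1).not_gt hp.1
  refine ((finite_vertices (Φ := Φ)).union
    (finite_iUnion fun i => (hfin i).image (Φ i))).subset fun q hq => ?_
  obtain ⟨i, t, ht, rfl⟩ := h.cover q
  rcases eq_endpoints_or_mem_Ioo_of_mem_Icc ht with rfl | rfl | ht'
  · exact Or.inl (Or.inl ⟨i, rfl⟩)
  · exact Or.inl (Or.inr ⟨i, rfl⟩)
  · exact Or.inr (mem_iUnion.2 ⟨i, t, ⟨ht', hq⟩, rfl⟩)

end IsEdgeSystem

/-- For every `δ` there is a finite set met by every connected set with two points at distance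
at least `δ`. -/
theorem IsEdgeSystem.exists_finite_cut {G : Type*} [MetricSpace G] {n : ℕ} {Φ : Fin n → ℝ → G}
    (h : IsEdgeSystem Φ) {δ : ℝ} (hδ : 0 < δ) :
    ∃ F : Set G, F.Finite ∧ ∀ C : Set G, IsConnected C → Disjoint C F →
      ∀ u ∈ C, ∀ v ∈ C, dist u v < δ := by
  have hmesh : ∀ i, ∃ N : ℕ, 0 < N ∧ ∀ s ∈ Icc (0 : ℝ) 1, ∀ t ∈ Icc (0 : ℝ) 1,
      |s - t| ≤ 1 / N → dist (Φ i s) (Φ i t) < δ := fun i => by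
    have huc := isCompact_Icc.uniformContinuousOn_of_continuous ((h.cont i).continuousOn (s := Icc 0 1))
    obtain ⟨ε, hε, hεd⟩ := Metric.uniformContinuousOn_iff.1 huc δ hδ
    obtain ⟨N, hN⟩ := exists_nat_one_div_lt hε
    refine ⟨N + 1, N.succ_pos, fun s hs t ht hst => hεd s hs t ht ?_⟩
    rw [Real.dist_eq]
    push_cast at hst
    linarith
  choose N hN0 hN using hmesh
  refine ⟨IsEdgeSystem.vertices Φ ∪
    ⋃ i, (fun k : ℕ => Φ i (k / N i)) '' (Finset.range (N i + 1) : Set ℕ),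
    IsEdgeSystem.finite_vertices.union (finite_iUnion fun i => (Finset.finite_toSet _).image _),
    fun C hC hd u hu v hv => ?_⟩
  rw [disjoint_union_right] at hd
  obtain ⟨i, hi⟩ := h.exists_subset_edge hC hd.1
  have hi' : C ⊆ Φ i '' Icc 0 1 := hi.trans (image_mono Ioo_subset_Icc_self)
  have hNpos : (0 : ℝ) < N i := by exact_mod_cast hN0 i
  have main : ∀ s ∈ Icc (0 : ℝ) 1, ∀ t ∈ Icc (0 : ℝ) 1, s ≤ t → Φ i s ∈ C → Φ i t ∈ C →
      |s - t| ≤ 1 / N i := fun s hs t ht hst hsC htC => by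
    by_contra! hlt
    rw [abs_sub_comm, abs_of_nonneg (sub_nonneg.2 hst)] at hlt
    set k : ℕ := ⌈s * N i⌉₊
    have hk1 : s ≤ k / N i := by
      rw [le_div_iff₀ hNpos]; exact Nat.le_ceil _
    have hk2 : (k : ℝ) / N i ≤ t := by
      have : (k : ℝ) < s * N i + 1 := Nat.ceil_lt_add_one (mul_nonneg hs.1 hNpos.le)
      have h3 : (k : ℝ) / N i ≤ (s * N i + 1) / N i := by gcongr
      have h4 : (s * N i + 1) / N i = s + 1 / N i := by field_simp
      linarith
    have hkN : k < N i + 1 := by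
      have h5 : (k : ℝ) / N i ≤ 1 := hk2.trans ht.2
      rw [div_le_one hNpos] at h5
      exact Nat.lt_succ_of_le (by exact_mod_cast h5)
    have hkC : Φ i (k / N i) ∈ C :=
      h.Icc_subset_preimage hC.isPreconnected hi' hs ht hsC htC ⟨hk1, hk2⟩
    exact disjoint_left.1 hd.2 hkC (mem_iUnion.2 ⟨i, k, by simpa using hkN, rfl⟩)
  obtain ⟨s, hs, rfl⟩ := hi' hu
  obtain ⟨t, ht, rfl⟩ := hi' hv
  rcases le_total s t with hst | hst
  · exact hN i s hs t ht (main s hs t ht hst hu hv)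
  · rw [dist_comm]
    exact hN i t ht s hs (main t ht s hs hst hv hu)

/-- Iterates `i` and `j` of a periodic subgraph meet only if `i` and `j` agree modulo the period. -/
theorem IsPeriodicSubgraph.image_iterate_mod {G : Type*} [TopologicalSpace G] {f : G → G}
    {K : Set G} {k : ℕ} (h : IsPeriodicSubgraph f K k) (i : ℕ) :
    f^[i % k] '' K = f^[i] '' K := by
  have hm : ∀ q : ℕ, f^[k * q] '' K = K := fun q => by
    induction q with
    | zero => simp
    | succ q ih => rw [Nat.mul_succ, Function.iterate_add, image_comp, h.2.2.1, ih]
  conv_rhs => rw [← Nat.mod_add_div i k, Function.iterate_add, image_comp, hm]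

theorem IsPeriodicSubgraph.image_congr {G : Type*} [TopologicalSpace G] {f : G → G}
    {K : Set G} {k : ℕ} (h : IsPeriodicSubgraph f K k) {i j : ℕ} (hij : i ≡ j [MOD k]) :
    f^[i] '' K = f^[j] '' K := by
  rw [← h.image_iterate_mod i, ← h.image_iterate_mod j, hij]

theorem IsPeriodicSubgraph.modEq {G : Type*} [TopologicalSpace G] {f : G → G}
    {K : Set G} {k : ℕ} (h : IsPeriodicSubgraph f K k) {i j : ℕ} {p : G}
    (hi : p ∈ f^[i] '' K) (hj : p ∈ f^[j] '' K) : i ≡ j [MOD k] := by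
  by_contra hne
  rw [← h.image_iterate_mod] at hi hj
  exact disjoint_left.1 (h.2.2.2 _ _ (Nat.mod_lt _ h.2.1) (Nat.mod_lt _ h.2.1) hne) hi hj

theorem mem_image_iterate_add {α : Type*} {f : α → α} {K : Set α} {i : ℕ} {p : α} (j : ℕ)
    (hp : p ∈ f^[i] '' K) : f^[j] p ∈ f^[j + i] '' K := by
  rw [Function.iterate_add, image_comp]
  exact mem_image_of_mem _ hp

theorem mem_image_iterate {α : Type*} {f : α → α} {K : Set α} {p : α} (j : ℕ)
    (hp : p ∈ K) : f^[j] p ∈ f^[j] '' K := mem_image_of_mem _ hp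

/-- Among more pairwise disjoint sets than points of `F`, one misses `F`. -/
theorem exists_disjoint_of_ncard_lt {α ι : Type*} {F : Set α} (hF : F.Finite) {S : Finset ι}
    (hS : F.ncard < S.card) {C : ι → Set α}
    (hC : ∀ i ∈ S, ∀ j ∈ S, i ≠ j → Disjoint (C i) (C j)) : ∃ i ∈ S, Disjoint (C i) F := by
  by_contra! hall
  have hex : ∀ i ∈ S, ∃ p, p ∈ C i ∧ p ∈ F := fun i hi => not_disjoint_iff.1 (hall i hi)
  obtain ⟨i₀, hi₀⟩ := Finset.card_pos.1 (hS.trans_le' (Nat.zero_le _))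
  have : Nonempty α := ⟨(hex i₀ hi₀).choose⟩
  choose! p hp using hex
  rw [ncard_eq_toFinset_card F hF] at hS
  obtain ⟨i, hi, j, hj, hij, hpij⟩ := Finset.exists_ne_map_eq_of_card_lt_of_maps_to hS
    (f := p) fun i hi => by simpa using (hp i hi).2
  exact disjoint_left.1 (hC i hi j hj hij) (hp i hi).1 (hpij ▸ (hp j hj).1)

section Omega

variable {G : Type*} [TopologicalSpace G] {f : G → G} {a p : G}

theorem mem_omegaSet_iff : p ∈ omegaSet f a ↔ MapClusterPt p atTop fun m => f^[m] a := by
  rw [mapClusterPt_atTop_iff_forall_mem_closure]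
  simp [omegaSet]

theorem mem_omegaSet_iff_frequently :
    p ∈ omegaSet f a ↔ ∀ U ∈ 𝓝 p, ∃ᶠ m in atTop, f^[m] a ∈ U := by
  rw [mem_omegaSet_iff, mapClusterPt_iff_frequently]

theorem isClosed_omegaSet : IsClosed (omegaSet f a) :=
  isClosed_iInter fun _ => isClosed_closure

theorem iterate_mem_omegaSet (hf : Continuous f) (hp : p ∈ omegaSet f a) (j : ℕ) :
    f^[j] p ∈ omegaSet f a := by
  induction j with
  | zero => exact hp
  | succ j ih =>
    rw [Function.iterate_succ_apply']
    rw [mem_omegaSet_iff_frequently] at ih ⊢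
    intro U hU
    have h1 := ih _ (hf.continuousAt.preimage_mem_nhds hU)
    rw [frequently_atTop] at h1 ⊢
    intro N
    obtain ⟨m, hm, hmU⟩ := h1 N
    exact ⟨m + 1, by omega, by rwa [Function.iterate_succ_apply']⟩

theorem omegaSet_subset (hf : Continuous f) (hp : p ∈ omegaSet f a) :
    omegaSet f p ⊆ omegaSet f a := by
  intro q hq
  rw [mem_omegaSet_iff_frequently] at hq
  refine isClosed_omegaSet.closure_subset (mem_closure_iff_nhds.2 fun U hU => ?_)
  obtain ⟨m, hm⟩ := (hq U hU).exists
  exact ⟨_, hm, iterate_mem_omegaSet hf hp m⟩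

theorem omegaSet_nonempty [CompactSpace G] : (omegaSet f a).Nonempty := by
  obtain ⟨p, hp⟩ := exists_clusterPt_of_compactSpace (map (fun m => f^[m] a) atTop)
  exact ⟨p, mem_omegaSet_iff.2 hp⟩

theorem exists_preimage_mem_omegaSet [CompactSpace G] [T2Space G] (hf : Continuous f)
    (hp : p ∈ omegaSet f a) (j : ℕ) : ∃ q ∈ omegaSet f a, f^[j] q = p := by
  rw [mem_omegaSet_iff, mapClusterPt_iff_ultrafilter] at hp
  obtain ⟨U, hU, hUp⟩ := hp
  obtain ⟨q, hq⟩ : ∃ q, Tendsto (fun m => f^[m - j] a) U (𝓝 q) := by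
    obtain ⟨q, -, hq⟩ := isCompact_univ.ultrafilter_le_nhds (U.map fun m => f^[m - j] a) (by simp)
    exact ⟨q, hq⟩
  refine ⟨q, ?_, ?_⟩
  · rw [mem_omegaSet_iff, mapClusterPt_iff_ultrafilter]
    refine ⟨U.map (· - j), ?_, ?_⟩
    · exact (tendsto_sub_atTop_nat j).mono_left hU
    · exact tendsto_map'_iff.2 hq
  · have h1 : Tendsto (fun m => f^[j] (f^[m - j] a)) U (𝓝 (f^[j] q)) :=
      ((hf.iterate j).tendsto q).comp hq
    refine tendsto_nhds_unique (h1.congr' ?_) hUp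
    filter_upwards [hU (eventually_ge_atTop j)] with m hm
    rw [← Function.iterate_add_apply, Nat.add_sub_cancel' hm]

/-- A closed forward invariant set entered by the orbit of `a` contains `ω(a)`. -/
theorem omegaSet_subset_of_mapsTo {X : Set G} (hX : IsClosed X) (hinv : MapsTo f X X) {m : ℕ}
    (hm : f^[m] a ∈ X) : omegaSet f a ⊆ X := by
  intro p hp
  by_contra hpX
  rw [mem_omegaSet_iff_frequently] at hp
  obtain ⟨i, hi, hiX⟩ := frequently_atTop.1 (hp _ (hX.isOpen_compl.mem_nhds hpX)) m
  obtain ⟨k, rfl⟩ := Nat.exists_eq_add_of_le' hi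
  rw [Function.iterate_add_apply] at hiX
  exact hiX (hinv.iterate k hm)

end Omega

section Cycle

variable {G : Type*} [TopologicalSpace G] {f : G → G} {K : Set G} {k : ℕ}

theorem IsPeriodicSubgraph.mem_orbit_iff (h : IsPeriodicSubgraph f K k) {p : G} :
    p ∈ ⋃ i ∈ Finset.range k, f^[i] '' K ↔ ∃ i, p ∈ f^[i] '' K := by
  simp only [mem_iUnion, Finset.mem_range, exists_prop]
  refine ⟨fun ⟨i, _, hi⟩ => ⟨i, hi⟩, fun ⟨i, hi⟩ => ⟨i % k, Nat.mod_lt _ h.2.1, ?_⟩⟩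
  rwa [h.image_iterate_mod]

theorem IsPeriodicSubgraph.mapsTo_orbit (h : IsPeriodicSubgraph f K k) :
    MapsTo f (⋃ i ∈ Finset.range k, f^[i] '' K) (⋃ i ∈ Finset.range k, f^[i] '' K) := by
  intro p hp
  rw [h.mem_orbit_iff] at hp ⊢
  obtain ⟨i, hi⟩ := hp
  exact ⟨1 + i, mem_image_iterate_add 1 hi⟩

theorem IsPeriodicSubgraph.isConnected_image (h : IsPeriodicSubgraph f K k) (hf : Continuous f)
    (i : ℕ) : IsConnected (f^[i] '' K) :=
  h.1.2.1.image _ (hf.iterate i).continuousOn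

variable [CompactSpace G] [T2Space G]

theorem IsPeriodicSubgraph.isClosed_image (h : IsPeriodicSubgraph f K k) (hf : Continuous f)
    (i : ℕ) : IsClosed (f^[i] '' K) :=
  (h.1.1.isCompact.image (hf.iterate i)).isClosed

theorem IsPeriodicSubgraph.isClosed_orbit (h : IsPeriodicSubgraph f K k) (hf : Continuous f) :
    IsClosed (⋃ i ∈ Finset.range k, f^[i] '' K) :=
  isClosed_biUnion_finset fun i _ => h.isClosed_image hf i

end Cycle

/-- A segment of a finite subset of the line: two consecutive points. -/
def IsGap (T : Set ℝ) (s t : ℝ) : Prop :=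
  s ∈ T ∧ t ∈ T ∧ s < t ∧ ∀ u ∈ T, u ≤ s ∨ t ≤ u

theorem Set.Finite.exists_isGap {T : Set ℝ} (hT : T.Finite) {u a b : ℝ} (ha : a ∈ T) (hb : b ∈ T)
    (hau : a ≤ u) (hub : u ≤ b) (hu : u ∉ T) : ∃ s t, IsGap T s t ∧ s < u ∧ u < t := by
  obtain ⟨s, hs, hsmax⟩ := (hT.subset (inter_subset_left (t := Iic u))).exists_maximalFor id _
    ⟨a, ha, hau⟩
  obtain ⟨t, ht, htmin⟩ := (hT.subset (inter_subset_left (t := Ici u))).exists_minimalFor id _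
    ⟨b, hb, hub⟩
  have hsu : s < u := lt_of_le_of_ne hs.2 fun e => hu (e ▸ hs.1)
  have hut : u < t := lt_of_le_of_ne ht.2 fun e => hu (e ▸ ht.1)
  refine ⟨s, t, ⟨hs.1, ht.1, hsu.trans hut, fun v hv => ?_⟩, hsu, hut⟩
  rcases le_total v u with h | h
  · exact Or.inl (le_of_not_gt fun hlt => hlt.not_ge (hsmax ⟨hv, h⟩ hlt.le))
  · exact Or.inr (le_of_not_gt fun hlt => hlt.not_ge (htmin ⟨hv, h⟩ hlt.le))

/-- A nondegenerate closed connected subset of a graph is a graph. -/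
theorem IsEdgeSystem.isTopGraph {G : Type*} [TopologicalSpace G] [T2Space G] [CompactSpace G]
    {n : ℕ} {Φ : Fin n → ℝ → G} (h : IsEdgeSystem Φ) {K : Set G} (hK : IsClosed K)
    (hC : IsConnected K) (hnt : K.Nontrivial) : IsTopGraph K := by
  have hfr := h.finite_frontier hK hC.isPreconnected
  have hconn : ConnectedSpace K := isConnected_iff_connectedSpace.1 hC
  have hnt' : Nontrivial K := hnt.coe_sort
  refine ⟨isCompact_iff_compactSpace.1 hK.isCompact, hconn, ?_⟩
  set T : Fin n → Set ℝ := fun i => {t ∈ Icc (0 : ℝ) 1 | t = 0 ∨ t = 1 ∨ Φ i t ∈ frontier K}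
  have hT0 : ∀ i, (0 : ℝ) ∈ T i := fun i => ⟨by simp, Or.inl rfl⟩
  have hT1 : ∀ i, (1 : ℝ) ∈ T i := fun i => ⟨by simp, Or.inr (Or.inl rfl)⟩
  have hTfin : ∀ i, (T i).Finite := fun i => by
    have h1 : {t ∈ Icc (0 : ℝ) 1 | Φ i t ∈ frontier K}.Finite :=
      Set.Finite.of_finite_image (f := Φ i) (hfr.subset (image_subset_iff.2 fun t ht => ht.2))
        ((h.inj i).mono fun t ht => ht.1)
    refine (((finite_singleton (0 : ℝ)).union (finite_singleton 1)).union h1).subset ?_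
    rintro t ⟨ht, rfl | rfl | ht'⟩
    · simp
    · simp
    · exact Or.inr ⟨ht, ht'⟩
  set W : Set (Fin n × ℝ × ℝ) :=
    {w | IsGap (T w.1) w.2.1 w.2.2 ∧ Φ w.1 '' Icc w.2.1 w.2.2 ⊆ K}
  have hWfin : W.Finite := by
    refine (finite_iUnion fun i => ((hTfin i).prod (hTfin i)).image (Prod.mk i)).subset ?_
    rintro ⟨i, s, t⟩ ⟨hg, -⟩
    exact mem_iUnion.2 ⟨i, (s, t), ⟨hg.1, hg.2.1⟩, rfl⟩
  have hIcc : ∀ w ∈ W, Icc w.2.1 w.2.2 ⊆ Icc (0 : ℝ) 1 := fun w hw =>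
    Icc_subset_Icc hw.1.1.1.1 hw.1.2.1.1.2
  -- Two segments share at most one point, and it is an endpoint of the first.
  have hend : ∀ w ∈ W, ∀ w' ∈ W, w ≠ w' → ∀ u ∈ Icc w.2.1 w.2.2, ∀ u' ∈ Icc w'.2.1 w'.2.2,
      Φ w.1 u = Φ w'.1 u' → u = w.2.1 ∨ u = w.2.2 := by
    rintro ⟨i, s, t⟩ hw ⟨j, s', t'⟩ hw' hne u hu u' hu' he
    have hu1 := hIcc _ hw hu
    have hu1' := hIcc _ hw' hu'
    simp only at hu hu' he hu1 hu1' ⊢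
    by_cases hij : i = j
    · subst hij
      obtain rfl := h.inj i hu1 hu1' he
      have g1 := hw.1.2.2.2 _ hw'.1.1
      have g2 := hw.1.2.2.2 _ hw'.1.2.1
      have g3 := hw'.1.2.2.2 _ hw.1.1
      have g4 := hw'.1.2.2.2 _ hw.1.2.1
      have g5 := hw.1.2.2.1
      have g6 := hw'.1.2.2.1
      simp only at g1 g2 g3 g4 g5 g6
      by_contra! hcon
      have h1 : s < u := lt_of_le_of_ne hu.1 (Ne.symm hcon.1)
      have h2 : u < t := lt_of_le_of_ne hu.2 hcon.2
      have e1 : s = s' := by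
        rcases g1 with g1 | g1 <;> rcases g3 with g3 | g3 <;> linarith [hu'.1, hu'.2]
      have e2 : t = t' := by
        rcases g2 with g2 | g2 <;> rcases g4 with g4 | g4 <;> linarith [hu'.1, hu'.2]
      exact hne (by rw [e1, e2])
    · have huT : u ∈ T i := by
        rcases h.eq_zero_or_one i j hij u hu1 u' hu1' he with rfl | rfl
        · exact hT0 i
        · exact hT1 i
      rcases hw.1.2.2.2 u huT with hle | hle
      · exact Or.inl (le_antisymm hle hu.1)
      · exact Or.inr (le_antisymm hu.2 hle)
  have huniq : ∀ w ∈ W, ∀ w' ∈ W, w ≠ w' → ∀ u ∈ Icc w.2.1 w.2.2, ∀ u' ∈ Icc w'.2.1 w'.2.2,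
      ∀ v ∈ Icc w.2.1 w.2.2, ∀ v' ∈ Icc w'.2.1 w'.2.2,
      Φ w.1 u = Φ w'.1 u' → Φ w.1 v = Φ w'.1 v' → Φ w.1 u = Φ w.1 v := by
    rintro w hw w' hw' hne u hu u' hu' v hv v' hv' he he'
    by_cases hij : w.1 = w'.1
    · have a1 := hend w hw w' hw' hne u hu u' hu' he
      have a2 := hend w' hw' w hw hne.symm u' hu' u hu he.symm
      have a3 := hend w hw w' hw' hne v hv v' hv' he'
      have a4 := hend w' hw' w hw hne.symm v' hv' v hv he'.symm
      rw [← hij] at he he'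
      have b1 := h.inj _ (hIcc _ hw hu) (hIcc _ hw' hu') he
      have b2 := h.inj _ (hIcc _ hw hv) (hIcc _ hw' hv') he'
      have c1 := hw.1.2.2.1
      have c2 := hw'.1.2.2.1
      by_contra huv
      have huv : u ≠ v := fun e => huv (by rw [e])
      refine hne (Prod.ext hij (Prod.ext ?_ ?_)) <;>
      rcases a1 with a1 | a1 <;> rcases a2 with a2 | a2 <;> rcases a3 with a3 | a3 <;>
        rcases a4 with a4 | a4 <;> first | linarith | exact absurd (by linarith) huv
    · exact h.uniq _ _ hij _ (hIcc _ hw hu) _ (hIcc _ hw' hu') _ (hIcc _ hw hv) _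
        (hIcc _ hw' hv') he he'
  have hcover : K ⊆ ⋃ w ∈ W, Φ w.1 '' Icc w.2.1 w.2.2 := by
    have hclosed : IsClosed (⋃ w ∈ W, Φ w.1 '' Icc w.2.1 w.2.2) :=
      hWfin.isClosed_biUnion fun w _ => (isCompact_Icc.image (h.cont w.1)).isClosed
    have hbad : (⋃ i, Φ i '' T i).Finite := finite_iUnion fun i => (hTfin i).image _
    have hgood : K \ (⋃ i, Φ i '' T i) ⊆ ⋃ w ∈ W, Φ w.1 '' Icc w.2.1 w.2.2 := by
      rintro q ⟨hq, hqT⟩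
      obtain ⟨i, u, hu, rfl⟩ := h.cover q
      have huT : u ∉ T i := fun hu' => hqT (mem_iUnion.2 ⟨i, u, hu', rfl⟩)
      obtain ⟨s, t, hg, hsu, hut⟩ := (hTfin i).exists_isGap (hT0 i) (hT1 i) hu.1 hu.2 huT
      have hsub : Φ i '' Ioo s t ⊆ K := by
        refine (isPreconnected_Ioo.image _ (h.cont i).continuousOn).subset_of_disjoint_frontier
          ⟨_, ⟨u, ⟨hsu, hut⟩, rfl⟩, hq⟩ (disjoint_left.2 ?_)
        rintro _ ⟨v, hv, rfl⟩ hvf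
        have hvT : v ∈ T i :=
          ⟨⟨hg.1.1.1.trans hv.1.le, hv.2.le.trans hg.2.1.1.2⟩, Or.inr (Or.inr hvf)⟩
        rcases hg.2.2.2 v hvT with hle | hle
        · exact hle.not_gt hv.1
        · exact hle.not_gt hv.2
      have hsub' : Icc s t ⊆ Φ i ⁻¹' K := by
        rw [← closure_Ioo hg.2.2.1.ne]
        exact closure_minimal (image_subset_iff.1 hsub) (hK.preimage (h.cont i))
      exact mem_biUnion (x := (i, s, t)) (show _ ∈ W from ⟨hg, image_subset_iff.2 hsub'⟩)
        ⟨u, ⟨hsu.le, hut.le⟩, rfl⟩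
    have hdense : Dense ((univ : Set K) \ Subtype.val ⁻¹' (⋃ i, Φ i '' T i)) :=
      dense_univ.sdiff_finite (hbad.preimage Subtype.val_injective.injOn)
    intro q hq
    have := (hclosed.preimage continuous_subtype_val).closure_subset_iff.2
      (fun p hp => hgood ⟨p.2, hp.2⟩) (hdense (⟨q, hq⟩ : K))
    exact this
  have : Fintype W := hWfin.fintype
  set e := Fintype.equivFin W
  refine ⟨Fintype.card W,
    fun k => Subtype.val ⁻¹' (Φ (e.symm k).1.1 '' Icc (e.symm k).1.2.1 (e.symm k).1.2.2),
    fun k => ⟨Φ (e.symm k).1.1 (e.symm k).1.2.1, (e.symm k).2.2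
      ⟨_, left_mem_Icc.2 (e.symm k).2.1.2.2.1.le, rfl⟩⟩,
    fun k => ⟨Φ (e.symm k).1.1 (e.symm k).1.2.2, (e.symm k).2.2
      ⟨_, right_mem_Icc.2 (e.symm k).2.1.2.2.1.le, rfl⟩⟩, fun k => ?_, ?_, fun k l hkl => ?_⟩
  · beta_reduce
    generalize e.symm k = w
    obtain ⟨⟨i, s, t⟩, hw⟩ := w
    have hlt : s < t := hw.1.2.2.1
    have hmem : ∀ r ∈ Icc (0 : ℝ) 1, s + (t - s) * r ∈ Icc s t := fun r hr =>
      ⟨by nlinarith [hr.1, hr.2], by nlinarith [hr.1, hr.2]⟩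
    refine ⟨fun r => ⟨Φ i (s + (t - s) * r), hw.2 ⟨_, hmem r r.2, rfl⟩⟩, ?_, ?_, ?_, ?_, ?_⟩
    · exact Continuous.subtype_mk ((h.cont i).comp (by fun_prop)) _
    · intro r r' hrr
      have h1 := h.inj i (hIcc _ hw (hmem r r.2)) (hIcc _ hw (hmem r' r'.2))
        (congrArg Subtype.val hrr)
      have h2 : (t - s) * (r : ℝ) = (t - s) * r' := by linarith
      exact Subtype.ext (mul_left_cancel₀ (sub_pos.2 hlt).ne' h2)
    · ext q
      constructor
      · rintro ⟨r, rfl⟩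
        exact ⟨_, hmem r r.2, rfl⟩
      · rintro ⟨u, hu, huq⟩
        have hpos : 0 < t - s := sub_pos.2 hlt
        refine ⟨⟨(u - s) / (t - s), div_nonneg (sub_nonneg.2 hu.1) hpos.le,
          (div_le_one hpos).2 (by linarith [hu.2])⟩, Subtype.ext ?_⟩
        rw [← huq]
        change Φ i (s + (t - s) * ((u - s) / (t - s))) = Φ i u
        congr 1
        field_simp
        ring
    · simp
    · simp
  · rw [eq_univ_iff_forall]
    intro q
    obtain ⟨w, hw, hq⟩ := mem_iUnion₂.1 (hcover q.2)
    exact mem_iUnion.2 ⟨e ⟨w, hw⟩, by simpa using hq⟩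
  · have hne : (e.symm k).1 ≠ (e.symm l).1 := fun he =>
      hkl (e.symm.injective (Subtype.ext he))
    beta_reduce
    generalize e.symm k = x at hne ⊢
    generalize e.symm l = x' at hne ⊢
    obtain ⟨w, hw⟩ := x
    obtain ⟨w', hw'⟩ := x'
    simp only at hne ⊢
    rw [or_iff_not_imp_left, ← Ne, ← nonempty_iff_ne_empty]
    rintro ⟨p, ⟨u, hu, hup⟩, ⟨u', hu', hup'⟩⟩
    have he := hup.trans hup'.symm
    refine ⟨p, ?_, ?_, ?_⟩
    · refine Subset.antisymm ?_ (singleton_subset_iff.2 ⟨⟨u, hu, hup⟩, ⟨u', hu', hup'⟩⟩)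
      rintro q ⟨⟨v, hv, hvq⟩, ⟨v', hv', hvq'⟩⟩
      refine Subtype.ext ?_
      rw [← hvq, ← hup]
      exact (huniq w hw w' hw' hne u hu u' hu' v hv v' hv' he (hvq.trans hvq'.symm)).symm
    · rcases hend w hw w' hw' hne u hu u' hu' he with rfl | rfl
      · exact Or.inl (Subtype.ext hup.symm)
      · exact Or.inr (Subtype.ext hup.symm)
    · rcases hend w' hw' w hw hne.symm u' hu' u hu he.symm with rfl | rfl
      · exact Or.inl (Subtype.ext hup'.symm)
      · exact Or.inr (Subtype.ext hup'.symm)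

theorem IsTopGraph.nontrivial {X : Type*} [TopologicalSpace X] (h : IsTopGraph X) :
    Nontrivial X := by
  obtain ⟨-, hc, n, A, a, b, hA, hU, -⟩ := h
  obtain ⟨q⟩ := hc.toNonempty
  obtain ⟨i, -⟩ := mem_iUnion.1 (hU ▸ mem_univ q : q ∈ ⋃ i, A i)
  obtain ⟨φ, -, hi, -⟩ := hA i
  exact hi.nontrivial

/-- Iterated images of a periodic subgraph are periodic subgraphs with the same period. -/
theorem IsPeriodicSubgraph.image {G : Type*} [TopologicalSpace G] [T2Space G] (hG : IsTopGraph G)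
    {f : G → G} (hf : Continuous f) {K : Set G} {k : ℕ} (h : IsPeriodicSubgraph f K k) (i : ℕ) :
    IsPeriodicSubgraph f (f^[i] '' K) k := by
  have := hG.1
  obtain ⟨n, Φ, hΦ⟩ := hG.exists_isEdgeSystem
  have himg : ∀ j, f^[j] '' (f^[i] '' K) = f^[j + i] '' K := fun j => by
    rw [Function.iterate_add, image_comp]
  have hnt : (f^[i] '' K).Nontrivial := by
    have hKnt : K.Nontrivial := nontrivial_coe_sort.1 h.1.2.2.nontrivial
    have h1 : f^[k * i - i] '' (f^[i] '' K) = K := by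
      rw [himg, Nat.sub_add_cancel (Nat.le_mul_of_pos_left i h.2.1),
        h.image_congr (j := 0) (by simp [Nat.ModEq])]
      simp
    rw [← h1] at hKnt
    exact nontrivial_of_image _ _ hKnt
  have hcl := h.isClosed_image hf i
  have hco := h.isConnected_image hf i
  refine ⟨⟨hcl, hco, hΦ.isTopGraph hcl hco hnt⟩, h.2.1, ?_, fun r s hr hs hrs => ?_⟩
  · rw [himg]
    exact h.image_congr (by simp [Nat.ModEq])
  · rw [himg, himg, disjoint_left]
    intro p hp hp'
    exact hrs ((Nat.ModEq.add_right_cancel' i (h.modEq hp hp')).eq_of_lt_of_lt hr hs)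

section Nested

variable {G : Type*} [MetricSpace G] {f : G → G} {x y : G}

theorem IsPeriodicSubgraph.finite_frontier_orbit (hG : IsTopGraph G) (hf : Continuous f)
    {K : Set G} {k : ℕ} (h : IsPeriodicSubgraph f K k) :
    (⋃ i, frontier (f^[i] '' K)).Finite := by
  have := hG.1
  obtain ⟨n, Φ, hΦ⟩ := hG.exists_isEdgeSystem
  refine ((finite_lt_nat k).biUnion fun i _ => hΦ.finite_frontier (h.isClosed_image hf i)
    (h.isConnected_image hf i).isPreconnected).subset (iUnion_subset fun i => ?_)
  rw [← h.image_iterate_mod]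
  exact subset_biUnion_of_mem (u := fun j => frontier (f^[j] '' K)) (Nat.mod_lt i h.2.1)

/-- Periodic subgraphs of large period meeting a periodic subgraph `K` are contained in `K`. -/
theorem IsPeriodicSubgraph.exists_subset_of_le (hG : IsTopGraph G) (hf : Continuous f)
    {K : Set G} {k : ℕ} (h : IsPeriodicSubgraph f K k) (hx : x ∈ K) :
    ∃ B, ∀ L l, IsPeriodicSubgraph f L l → B ≤ l → x ∈ L → L ⊆ K := by
  refine ⟨(⋃ i, frontier (f^[i] '' K)).ncard + 1, fun L l hL hl hxL => ?_⟩
  obtain ⟨i, hi, hd⟩ := exists_disjoint_of_ncard_lt (h.finite_frontier_orbit hG hf)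
    (S := Finset.range l) (C := fun i => f^[i] '' L) (by simpa using hl)
    fun i hi j hj hij => hL.2.2.2 i j (Finset.mem_range.1 hi) (Finset.mem_range.1 hj) hij
  have hsub : f^[i] '' L ⊆ f^[i] '' K :=
    (hL.isConnected_image hf i).isPreconnected.subset_of_disjoint_frontier
      ⟨f^[i] x, mem_image_iterate i hxL, mem_image_iterate i hx⟩
      (hd.mono_right (subset_iUnion (fun i => frontier (f^[i] '' K)) i))
  have hle : l - i + i = l := Nat.sub_add_cancel (Finset.mem_range.1 hi).le
  have hLK : L ⊆ f^[l] '' K := by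
    have h1 := image_mono (f := f^[l - i]) hsub
    rwa [← image_comp, ← image_comp, ← Function.iterate_add, hle, hL.2.2.1] at h1
  have hmod : l ≡ 0 [MOD k] := h.modEq (hLK hxL) (by simpa using hx)
  rw [h.image_congr hmod] at hLK
  simpa using hLK

theorem exists_nested_of_unbounded (hG : IsTopGraph G) (hf : Continuous f)
    (h : ∀ B, ∃ L l, B ≤ l ∧ IsPeriodicSubgraph f L l ∧ x ∈ L ∧ y ∈ L) :
    ∃ (J : ℕ → Set G) (m : ℕ → ℕ), (∀ n, IsPeriodicSubgraph f (J n) (m n)) ∧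
      (∀ n, J (n + 1) ⊆ J n) ∧ Tendsto m atTop atTop ∧ ∀ n, x ∈ J n ∧ y ∈ J n := by
  let P := {p : Set G × ℕ // IsPeriodicSubgraph f p.1 p.2 ∧ x ∈ p.1 ∧ y ∈ p.1}
  have hnext : ∀ (N : ℕ) (p : P), ∃ q : P, q.1.1 ⊆ p.1.1 ∧ N ≤ q.1.2 := by
    rintro N ⟨⟨K, k⟩, hK, hxK, hyK⟩
    obtain ⟨B, hB⟩ := hK.exists_subset_of_le hG hf hxK
    obtain ⟨L, l, hl, hL, hxL, hyL⟩ := h (max B N)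
    exact ⟨⟨(L, l), hL, hxL, hyL⟩, hB L l hL ((le_max_left _ _).trans hl) hxL,
      (le_max_right _ _).trans hl⟩
  choose next hnext_sub hnext_le using hnext
  obtain ⟨L, l, -, hL, hxL, hyL⟩ := h 0
  let s : ℕ → P := fun n => Nat.rec ⟨(L, l), hL, hxL, hyL⟩ (fun n p => next n p) n
  refine ⟨fun n => (s n).1.1, fun n => (s n).1.2, fun n => (s n).2.1,
    fun n => hnext_sub n (s n), ?_, fun n => (s n).2.2⟩
  rw [← tendsto_add_atTop_iff_nat 1]
  exact tendsto_atTop_mono (fun n => hnext_le n (s n)) tendsto_id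

variable {J : ℕ → Set G} {m : ℕ → ℕ}

theorem not_separable_of_nested (hG : IsTopGraph G) (hf : Continuous f)
    (hJ : ∀ n, IsPeriodicSubgraph f (J n) (m n)) (hm : Tendsto m atTop atTop)
    (hx : ∀ n, x ∈ J n) (hy : ∀ n, y ∈ J n) : ¬ SeparablePoints f x y := by
  rintro ⟨I, I', k, k', hI, hI', hd, hxI, hyI'⟩
  set D := ⋃ i, frontier (f^[i] '' I)
  obtain ⟨n, hn⟩ := (hm.eventually_gt_atTop (k * k' * D.ncard)).exists
  have hkk : 0 < k * k' := Nat.mul_pos hI.2.1 hI'.2.1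
  have hlt : ∀ t ∈ Finset.range (D.ncard + 1), k * k' * t < m n := fun t ht =>
    (Nat.mul_le_mul_left _ (Nat.lt_succ_iff.1 (Finset.mem_range.1 ht))).trans_lt hn
  obtain ⟨t, ht, htd⟩ := exists_disjoint_of_ncard_lt (hI.finite_frontier_orbit hG hf)
    (S := Finset.range (D.ncard + 1)) (C := fun t => f^[k * k' * t] '' J n) (by simp [D])
    fun i hi j hj hij => (hJ n).2.2.2 _ _ (hlt i hi) (hlt j hj) fun he =>
      hij (Nat.eq_of_mul_eq_mul_left hkk he)
  have hxt : f^[k * k' * t] x ∈ I := by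
    have h1 := mem_image_iterate (f := f) (k * k' * t) hxI
    rw [hI.image_congr (j := 0) (by simp [Nat.ModEq, mul_assoc])] at h1
    simpa using h1
  have hyt : f^[k * k' * t] y ∈ I' := by
    have h1 := mem_image_iterate (f := f) (k * k' * t) hyI'
    rw [hI'.image_congr (j := 0) (by simp [Nat.ModEq, mul_comm k, mul_assoc])] at h1
    simpa using h1
  have hsub : f^[k * k' * t] '' J n ⊆ I :=
    ((hJ n).isConnected_image hf _).isPreconnected.subset_of_disjoint_frontier
      ⟨_, mem_image_iterate _ (hx n), hxt⟩
      (htd.mono_right (by simpa using subset_iUnion (fun i => frontier (f^[i] '' I)) 0))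
  exact disjoint_left.1 hd (hsub (mem_image_iterate _ (hy n))) hyt

theorem injective_iterate_of_nested (hJ : ∀ n, IsPeriodicSubgraph f (J n) (m n))
    (hm : Tendsto m atTop atTop) (hx : ∀ n, x ∈ J n) :
    Function.Injective fun i => f^[i] x := by
  intro i j hij
  obtain ⟨n, hn⟩ := (hm.eventually_gt_atTop (max i j)).exists
  have h1 := mem_image_iterate (f := f) i (hx n)
  have h2 := mem_image_iterate (f := f) j (hx n)
  simp only at hij
  rw [hij] at h1
  exact ((hJ n).modEq h1 h2).eq_of_lt_of_lt ((le_max_left _ _).trans_lt hn)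
    ((le_max_right _ _).trans_lt hn)

theorem omegaSet_subset_orbit_of_nested (hG : IsTopGraph G) (hf : Continuous f)
    (hJ : ∀ n, IsPeriodicSubgraph f (J n) (m n)) (hm : Tendsto m atTop atTop)
    (hx : ∀ n, x ∈ J n) {a : G} (ha : x ∈ omegaSet f a) (n : ℕ) :
    omegaSet f a ⊆ ⋃ i ∈ Finset.range (m n), f^[i] '' J n := by
  have := hG.1
  have hinj := injective_iterate_of_nested hJ hm hx
  obtain ⟨_, ⟨i, rfl⟩, hi⟩ :=
    (infinite_range_of_injective hinj).exists_notMem_finite ((hJ n).finite_frontier_orbit hG hf)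
  have hmem := mem_image_iterate (f := f) i (hx n)
  have hxint : f^[i] x ∈ interior (f^[i] '' J n) := by
    by_contra hni
    exact hi (mem_iUnion.2 ⟨i, (mem_frontier_iff_notMem_interior hmem).2 hni⟩)
  obtain ⟨k, hk⟩ := (mem_omegaSet_iff_frequently.1 (iterate_mem_omegaSet hf ha i) _
    (isOpen_interior.mem_nhds hxint)).exists
  exact omegaSet_subset_of_mapsTo ((hJ n).isClosed_orbit hf) (hJ n).mapsTo_orbit
    ((hJ n).mem_orbit_iff.2 ⟨i, interior_subset hk⟩)

theorem isSolenoid_of_nested (hG : IsTopGraph G) (hf : Continuous f)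
    (hJ : ∀ n, IsPeriodicSubgraph f (J n) (m n)) (hm : Tendsto m atTop atTop)
    (hx : ∀ n, x ∈ J n) {a : G} (ha : x ∈ omegaSet f a) : IsSolenoid f (omegaSet f a) := by
  refine ⟨?_, fun N => ?_⟩
  · refine (infinite_range_of_injective (injective_iterate_of_nested hJ hm hx)).mono ?_
    rintro _ ⟨i, rfl⟩
    exact iterate_mem_omegaSet hf ha i
  · obtain ⟨n, hn⟩ := (hm.eventually_ge_atTop N).exists
    exact ⟨_, m n, hn, ⟨J n, hJ n, rfl⟩, omegaSet_subset_orbit_of_nested hG hf hJ hm hx ha n⟩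

theorem eventually_dist_iterate_lt (hG : IsTopGraph G) (hf : Continuous f)
    (hJ : ∀ n, IsPeriodicSubgraph f (J n) (m n)) (hm : Tendsto m atTop atTop)
    (hx : ∀ n, x ∈ J n) (hy : ∀ n, y ∈ J n) {δ : ℝ} (hδ : 0 < δ) :
    ∀ᶠ i in atTop, dist (f^[i] x) (f^[i] y) < δ := by
  obtain ⟨_, Φ, hΦ⟩ := hG.exists_isEdgeSystem
  obtain ⟨F, hF, hcut⟩ := hΦ.exists_finite_cut hδ
  rw [← Nat.cofinite_eq_atTop, eventually_cofinite]
  by_contra hinf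
  obtain ⟨S, hS, hcard⟩ := Set.Infinite.exists_subset_card_eq hinf (F.ncard + 1)
  obtain ⟨n, hn⟩ := (hm.eventually_gt_atTop (S.sup id)).exists
  have hlt : ∀ i ∈ S, i < m n := fun i hi => (Finset.le_sup (f := id) hi).trans_lt hn
  obtain ⟨i, hi, hd⟩ := exists_disjoint_of_ncard_lt hF (S := S) (C := fun i => f^[i] '' J n)
    (by omega) fun i hi j hj hij => (hJ n).2.2.2 _ _ (hlt i hi) (hlt j hj) hij
  exact hS hi (hcut _ ((hJ n).isConnected_image hf i) hd _ (mem_image_iterate i (hx n)) _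
    (mem_image_iterate i (hy n)))

theorem omegaSet_subset_omegaSet_of_nested (hG : IsTopGraph G) (hf : Continuous f)
    (hJ : ∀ n, IsPeriodicSubgraph f (J n) (m n)) (hm : Tendsto m atTop atTop)
    (hx : ∀ n, x ∈ J n) (hy : ∀ n, y ∈ J n) : omegaSet f x ⊆ omegaSet f y := by
  intro c hc
  rw [mem_omegaSet_iff_frequently] at hc ⊢
  intro U hU
  obtain ⟨ε, hε, hball⟩ := Metric.mem_nhds_iff.1 hU
  refine ((hc _ (Metric.ball_mem_nhds c (half_pos hε))).and_eventually
    (eventually_dist_iterate_lt hG hf hJ hm hx hy (half_pos hε))).mono fun i hi => hball ?_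
  rw [Metric.mem_ball]
  linarith [dist_triangle_left (f^[i] y) c (f^[i] x), Metric.mem_ball.1 hi.1]

/-- Open sets contained in images of periodic subgraphs of arbitrarily large periods
are wandering. -/
theorem disjoint_omegaSet_of_isOpen (hJ : ∀ n, IsPeriodicSubgraph f (J n) (m n))
    (hm : Tendsto m atTop atTop) {U : Set G} (hU : IsOpen U) {r : ℕ → ℕ} {n₀ : ℕ}
    (hUJ : ∀ n ≥ n₀, U ⊆ f^[r n] '' J n) (a : G) : Disjoint U (omegaSet f a) := by
  rw [disjoint_left]
  intro c hcU hc
  have hfreq := mem_omegaSet_iff_frequently.1 hc U (hU.mem_nhds hcU)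
  obtain ⟨i, hi⟩ := hfreq.exists
  obtain ⟨i', hii', hi'⟩ := frequently_atTop.1 hfreq (i + 1)
  obtain ⟨d, rfl⟩ := Nat.exists_eq_add_of_le' (Nat.le_of_succ_le hii')
  obtain ⟨n, hn, hn₀⟩ := ((hm.eventually_gt_atTop d).and (eventually_ge_atTop n₀)).exists
  have h1 := mem_image_iterate_add d (hUJ n hn₀ hi)
  rw [← Function.iterate_add_apply] at h1
  have h2 : d + r n ≡ 0 + r n [MOD m n] := by
    simpa using (hJ n).modEq h1 (hUJ n hn₀ hi')
  have h3 := (Nat.ModEq.add_right_cancel' _ h2).eq_of_lt_of_lt hn (hJ n).2.1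
  omega

theorem exists_common_omegaSet_of_nested (hG : IsTopGraph G) (hf : Continuous f)
    (hJ : ∀ n, IsPeriodicSubgraph f (J n) (m n)) (hsub : ∀ n, J (n + 1) ⊆ J n)
    (hm : Tendsto m atTop atTop) (hx : ∀ n, x ∈ J n) (hy : ∀ n, y ∈ J n) (hxy : x ≠ y) {a b : G}
    (ha : x ∈ omegaSet f a) (hb : y ∈ omegaSet f b) :
    y ∈ omegaSet f a ∨ x ∈ omegaSet f b := by
  have := hG.1
  obtain ⟨_, Φ, hΦ⟩ := hG.exists_isEdgeSystem
  have hanti : Antitone J := antitone_nat_of_succ_le hsub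
  -- Pull `J n₀` back along the cycle to an image lying in the interior of an edge.
  obtain ⟨n₀, hn₀⟩ := (hm.eventually_gt_atTop (IsEdgeSystem.vertices Φ).ncard).exists
  obtain ⟨i, hi, hiV⟩ := exists_disjoint_of_ncard_lt IsEdgeSystem.finite_vertices
    (S := Finset.range (m n₀)) (C := fun i => f^[i] '' J n₀) (by simpa using hn₀)
    fun i hi j hj hij => (hJ n₀).2.2.2 i j (Finset.mem_range.1 hi) (Finset.mem_range.1 hj) hij
  obtain ⟨e, he⟩ := hΦ.exists_subset_edge ((hJ n₀).isConnected_image hf i) hiV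
  obtain ⟨j, hij⟩ : ∃ j, j + i = m n₀ :=
    ⟨m n₀ - i, Nat.sub_add_cancel (Finset.mem_range.1 hi).le⟩
  set r : ℕ → ℕ := fun n => (m n - 1) * j
  have hr : ∀ n, j + r n ≡ 0 [MOD m n] := fun n => by
    have h1 : j + r n = m n * j := by
      obtain ⟨k, hk⟩ := Nat.exists_eq_add_of_le' (hJ n).2.1
      simp only [r, hk, Nat.add_sub_cancel]
      ring
    simp [Nat.ModEq, h1]
  have hpull : ∀ n k p, p ∈ f^[k] '' J n → f^[j] p ∈ J n → p ∈ f^[r n] '' J n :=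
    fun n k p hp hjp => by
      have h1 : j + k ≡ 0 [MOD m n] :=
        (hJ n).modEq (mem_image_iterate_add j hp) (by simpa using hjp)
      rwa [← (hJ n).image_congr (Nat.ModEq.add_left_cancel' j (h1.trans (hr n).symm))]
  have hpush : ∀ n p, p ∈ f^[r n] '' J n → f^[j] p ∈ J n := fun n p hp => by
    have h1 := mem_image_iterate_add j hp
    rw [(hJ n).image_congr (hr n)] at h1
    simpa using h1
  have hedge : ∀ n ≥ n₀, f^[r n] '' J n ⊆ Φ e '' Ioo 0 1 := fun n hn p hp => by
    have h1 := hpull n₀ _ p (image_mono (hanti hn) hp) (hanti hn (hpush n p hp))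
    have h2 : j + r n₀ ≡ j + i [MOD m n₀] := (hr n₀).trans (by simp [Nat.ModEq, hij])
    rw [(hJ n₀).image_congr (Nat.ModEq.add_left_cancel' j h2)] at h1
    exact he h1
  have hback : ∀ {p c : G}, (∀ n, p ∈ J n) → p ∈ omegaSet f c →
      ∃ q ∈ omegaSet f c, f^[j] q = p ∧ ∀ n, q ∈ f^[r n] '' J n := fun {p c} hp hpc => by
    obtain ⟨q, hqc, rfl⟩ := exists_preimage_mem_omegaSet hf hpc j
    refine ⟨q, hqc, rfl, fun n => ?_⟩
    obtain ⟨k, hk⟩ := (hJ n).mem_orbit_iff.1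
      (omegaSet_subset_orbit_of_nested hG hf hJ hm hp hpc n hqc)
    exact hpull n k q hk (hp n)
  -- The intersection of the pullbacks contains at most two points of limit sets.
  have hthree : ∀ u v w c, u ∈ Ioo (0 : ℝ) 1 → v ∈ Ioo u w → w ∈ Ioo (0 : ℝ) 1 →
      (∀ n, Φ e u ∈ f^[r n] '' J n) → (∀ n, Φ e w ∈ f^[r n] '' J n) → Φ e v ∉ omegaSet f c := by
    intro u v w c hu hv hw hun hwn hvc
    refine disjoint_left.1 (disjoint_omegaSet_of_isOpen hJ hm
      (hΦ.isOpen_image e isOpen_Ioo (Ioo_subset_Ioo hu.1.le hw.2.le)) (r := r) (n₀ := n₀)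
      (fun n hn => ?_) c) ⟨v, hv, rfl⟩ hvc
    refine image_subset_iff.2 (Ioo_subset_Icc_self.trans ?_)
    exact hΦ.Icc_subset_preimage ((hJ n).isConnected_image hf _).isPreconnected
      ((hedge n hn).trans (image_mono Ioo_subset_Icc_self)) (Ioo_subset_Icc_self hu)
      (Ioo_subset_Icc_self hw) (hun n) (hwn n)
  obtain ⟨s₀, hs₀, hs₀J⟩ : ∃ s, s ∈ omegaSet f x ∧ ∀ n, s ∈ J n := by
    have hne : (⋂ n, omegaSet f x ∩ J n).Nonempty := by
      refine IsCompact.nonempty_iInter_of_sequence_nonempty_isCompact_isClosed _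
        (fun n => inter_subset_inter_right _ (hsub n)) (fun n => ?_)
        (isClosed_omegaSet.inter (hJ 0).1.1).isCompact
        fun n => isClosed_omegaSet.inter (hJ n).1.1
      obtain ⟨c, hc⟩ := omegaSet_nonempty (f := f) (a := x)
      have horb : omegaSet f x ⊆ ⋃ i ∈ Finset.range (m n), f^[i] '' J n :=
        omegaSet_subset_of_mapsTo ((hJ n).isClosed_orbit hf) (hJ n).mapsTo_orbit (m := 0)
          ((hJ n).mem_orbit_iff.2 ⟨0, by simpa using hx n⟩)
      obtain ⟨k, hk⟩ := (hJ n).mem_orbit_iff.1 (horb hc)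
      refine ⟨f^[(m n - 1) * k] c, iterate_mem_omegaSet hf hc _, ?_⟩
      have h1 := mem_image_iterate_add ((m n - 1) * k) hk
      have h2 : (m n - 1) * k + k ≡ 0 [MOD m n] := by
        obtain ⟨l, hl⟩ := Nat.exists_eq_add_of_le' (hJ n).2.1
        have h3 : (m n - 1) * k + k = m n * k := by
          rw [hl, Nat.add_sub_cancel]
          ring
        simp [Nat.ModEq, h3]
      rw [(hJ n).image_congr h2] at h1
      simpa using h1
    obtain ⟨s, hs⟩ := hne
    rw [mem_iInter] at hs
    exact ⟨s, (hs 0).1, fun n => (hs n).2⟩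
  have hωa : omegaSet f x ⊆ omegaSet f a := omegaSet_subset hf ha
  have hωb : omegaSet f x ⊆ omegaSet f b :=
    (omegaSet_subset_omegaSet_of_nested hG hf hJ hm hx hy).trans (omegaSet_subset hf hb)
  obtain ⟨s, hsω, -, hsJ⟩ := hback hs₀J hs₀
  obtain ⟨x', hx'ω, hx'j, hx'J⟩ := hback hx ha
  obtain ⟨y', hy'ω, hy'j, hy'J⟩ := hback hy hb
  by_cases hsx : s = x'
  · right
    rw [← hx'j, ← hsx]
    exact iterate_mem_omegaSet hf (hωb hsω) j
  by_cases hsy : s = y'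
  · left
    rw [← hy'j, ← hsy]
    exact iterate_mem_omegaSet hf (hωa hsω) j
  exfalso
  have hxy' : x' ≠ y' := fun h => hxy (by rw [← hx'j, ← hy'j, h])
  obtain ⟨u, hu, rfl⟩ := hedge n₀ le_rfl (hsJ n₀)
  obtain ⟨v, hv, rfl⟩ := hedge n₀ le_rfl (hx'J n₀)
  obtain ⟨w, hw, rfl⟩ := hedge n₀ le_rfl (hy'J n₀)
  have huv : u ≠ v := fun h => hsx (by rw [h])
  have huw : u ≠ w := fun h => hsy (by rw [h])
  have hvw : v ≠ w := fun h => hxy' (by rw [h])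
  rcases huv.lt_or_gt with h1 | h1 <;> rcases huw.lt_or_gt with h2 | h2 <;>
    rcases hvw.lt_or_gt with h3 | h3
  · exact hthree u v w a hu ⟨h1, h3⟩ hw hsJ hy'J hx'ω
  · exact hthree u w v b hu ⟨h2, h3⟩ hv hsJ hx'J hy'ω
  · exact absurd (h1.trans h3) h2.not_gt
  · exact hthree w u v x hw ⟨h2, h1⟩ hv hy'J hx'J hsω
  · exact hthree v u w x hv ⟨h1, h2⟩ hw hx'J hy'J hsω
  · exact absurd (h2.trans h3) h1.not_gt
  · exact hthree v w u b hv ⟨h3, h2⟩ hu hx'J hsJ hy'ω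
  · exact hthree w v u a hw ⟨h3, h1⟩ hu hy'J hsJ hx'ω

end Nested

/-- `⟨x,y⟩` is an NS-pair iff `x` and `y` are non-separable and contained in some
solenoid `ω_f(z)`. -/
theorem nsPair_iff_nonseparable_in_solenoid {G : Type*} [MetricSpace G]
    (hG : IsTopGraph G) (f : G → G) (hf : Continuous f) (x y : G) (hxy : x ≠ y) :
    IsNSPair f x y ↔
      (¬ SeparablePoints f x y ∧
        ∃ z : G, IsSolenoid f (omegaSet f z) ∧ x ∈ omegaSet f z ∧ y ∈ omegaSet f z) := by
  constructor
  · rintro ⟨-, hxω, hyω, J, m, hJ, hsub, hm, hJxy⟩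
    have hx := fun n => (hJxy n).1
    have hy := fun n => (hJxy n).2
    refine ⟨not_separable_of_nested hG hf hJ hm hx hy, ?_⟩
    obtain ⟨a, ha⟩ := mem_iUnion.1 hxω
    obtain ⟨b, hb⟩ := mem_iUnion.1 hyω
    rcases exists_common_omegaSet_of_nested hG hf hJ hsub hm hx hy hxy ha hb with h | h
    · exact ⟨a, isSolenoid_of_nested hG hf hJ hm hx ha, ha, h⟩
    · exact ⟨b, isSolenoid_of_nested hG hf hJ hm hy hb, h, hb⟩
  · rintro ⟨hsep, z, hz, hxz, hyz⟩
    refine ⟨hxy, mem_iUnion.2 ⟨z, hxz⟩, mem_iUnion.2 ⟨z, hyz⟩,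
      exists_nested_of_unbounded hG hf fun B => ?_⟩
    obtain ⟨_, k, hBk, ⟨K, hK, rfl⟩, hsub⟩ := hz.2 B
    obtain ⟨i, hi⟩ := hK.mem_orbit_iff.1 (hsub hxz)
    obtain ⟨j, hj⟩ := hK.mem_orbit_iff.1 (hsub hyz)
    refine ⟨f^[i] '' K, k, hBk, hK.image hG hf i, hi, ?_⟩
    by_contra hyi
    refine hsep ⟨_, _, k, k, hK.image hG hf i, hK.image hG hf j, ?_, hi, hj⟩
    rw [disjoint_left]
    intro p hp hp'
    exact hyi (hK.image_congr (hK.modEq hp hp') ▸ hj)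
end

section
/- Let f : G → G be a graph map and x ∈ G such that ω_f(x) is a solenoid. Then every connected component of P(x), the intersection of all cycles of graphs containing ω_f(x), contains a point belonging to the closure of the set of periodic points of f. -/
open Set Filter Topology

theorem IsPreconnected.subset_of_disjoint_frontier_s16 {X : Type*} [TopologicalSpace X]
    {L Z : Set X} (hL : IsPreconnected L) (hd : Disjoint L (frontier Z))
    (hne : (L ∩ Z).Nonempty) : L ⊆ Z := by
  have hcov : L ⊆ interior Z ∪ (closure Z)ᶜ := by
    intro z hz
    by_cases hi : z ∈ interior Z
    · exact Or.inl hi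
    · exact Or.inr fun hc => hd.notMem_of_mem_left hz ⟨hc, hi⟩
  have hdisj : Disjoint (interior Z) (closure Z)ᶜ :=
    disjoint_compl_right.mono_left (interior_subset.trans subset_closure)
  obtain ⟨z, hzL, hzZ⟩ := hne
  have hzi : z ∈ interior Z := (hcov hzL).resolve_right fun h => h (subset_closure hzZ)
  exact (hL.subset_left_of_subset_union isOpen_interior isClosed_closure.isOpen_compl hdisj hcov
    ⟨z, hzL, hzi⟩).trans interior_subset

theorem isPreconnected_iInter_of_directed {X ι : Type*} [TopologicalSpace X] [T2Space X]
    [Nonempty ι] {V : ι → Set X} (hdir : Directed (· ⊇ ·) V) (hcomp : ∀ i, IsCompact (V i))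
    (hconn : ∀ i, IsPreconnected (V i)) : IsPreconnected (⋂ i, V i) := by
  rw [isPreconnected_iff_subset_of_disjoint_closed]
  intro u v hu hv huv hdisj
  have hs : IsCompact (⋂ i, V i) := (hcomp (Classical.arbitrary ι)).of_isClosed_subset
    (isClosed_iInter fun i => (hcomp i).isClosed) (Set.iInter_subset _ _)
  have hsep : SeparatedNhds ((⋂ i, V i) ∩ u) ((⋂ i, V i) ∩ v) := by
    refine SeparatedNhds.of_isCompact_isCompact (hs.inter_right hu) (hs.inter_right hv) ?_
    rw [Set.disjoint_iff_inter_eq_empty, ← Set.inter_inter_distrib_left]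
    exact hdisj
  obtain ⟨U, W, hU, hW, huU, hvW, hUW⟩ := hsep
  have hcov : (⋂ i, V i) ⊆ U ∪ W := fun z hz =>
    (huv hz).imp (fun h => huU ⟨hz, h⟩) (fun h => hvW ⟨hz, h⟩)
  obtain ⟨i, hi⟩ := exists_subset_nhds_of_isCompact hdir hcomp
    (fun z hz => (hU.union hW).mem_nhds (hcov hz))
  rcases (isPreconnected_iff_subset_of_disjoint.1 (hconn i)) U W hU hW hi
    (by rw [hUW.inter_eq, Set.inter_empty]) with h | h
  · left
    intro z hz
    refine (huv hz).resolve_right fun hzv => ?_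
    exact hUW.notMem_of_mem_left (h (Set.mem_iInter.1 hz i)) (hvW ⟨hz, hzv⟩)
  · right
    intro z hz
    refine (huv hz).resolve_left fun hzu => ?_
    exact hUW.notMem_of_mem_left (huU ⟨hz, hzu⟩) (h (Set.mem_iInter.1 hz i))

/-- A closed set `A` with a coordinate `r : X → ℝ` that is injective on `A` and whose
open unit stratum is open in `X`: the local model of an edge of a graph. -/
structure IsEdgeCoordinate {X : Type*} [TopologicalSpace X] (A : Set X) (r : X → ℝ) : Prop where
  isClosed : IsClosed A
  continuous : Continuous r
  injOn : Set.InjOn r A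
  isOpen : IsOpen (A ∩ r ⁻¹' Set.Ioo 0 1)

namespace IsEdgeCoordinate

variable {X : Type*} [TopologicalSpace X] {A : Set X} {r : X → ℝ}

theorem isOpen_Ioo (h : IsEdgeCoordinate A r) {s t : ℝ} (hs : 0 ≤ s) (ht : t ≤ 1) :
    IsOpen (A ∩ r ⁻¹' Set.Ioo s t) := by
  have : A ∩ r ⁻¹' Set.Ioo s t = (A ∩ r ⁻¹' Set.Ioo 0 1) ∩ r ⁻¹' Set.Ioo s t := by
    rw [Set.inter_assoc, ← Set.preimage_inter,
      Set.inter_eq_right.2 (Set.Ioo_subset_Ioo hs ht)]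
  rw [this]
  exact h.isOpen.inter (_root_.isOpen_Ioo.preimage h.continuous)

theorem frontier_Ioo_subset (h : IsEdgeCoordinate A r) {s t : ℝ} (hs : 0 ≤ s) (ht : t ≤ 1) :
    frontier (A ∩ r ⁻¹' Set.Ioo s t) ⊆ A ∩ r ⁻¹' {s, t} := by
  rw [(h.isOpen_Ioo hs ht).frontier_eq]
  rintro z ⟨hz, hz'⟩
  have hcl : IsClosed (A ∩ r ⁻¹' Set.Icc s t) :=
    h.isClosed.inter (isClosed_Icc.preimage h.continuous)
  obtain ⟨hA, h1, h2⟩ := closure_minimal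
    (Set.inter_subset_inter_right A (Set.preimage_mono Set.Ioo_subset_Icc_self)) hcl hz
  refine ⟨hA, ?_⟩
  by_contra hcon
  simp only [Set.mem_preimage, Set.mem_insert_iff, Set.mem_singleton_iff, not_or] at hcon
  exact hz' ⟨hA, lt_of_le_of_ne h1 (Ne.symm hcon.1), lt_of_le_of_ne h2 hcon.2⟩

theorem finite_frontier_unit (h : IsEdgeCoordinate A r) :
    (frontier (A ∩ r ⁻¹' Set.Ioo 0 1)).Finite := by
  refine Set.Finite.subset ?_ (h.frontier_Ioo_subset le_rfl le_rfl)
  refine Set.Finite.of_finite_image (f := r) ?_ (h.injOn.mono Set.inter_subset_left)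
  exact (Set.toFinite {(0 : ℝ), 1}).subset (by rintro _ ⟨z, hz, rfl⟩; exact hz.2)

theorem subset_of_between (h : IsEdgeCoordinate A r) {K : Set X} (hK : IsPreconnected K)
    {y x y' : X} (hy : y ∈ A ∩ r ⁻¹' Set.Ioo 0 1) (hy' : y' ∈ A ∩ r ⁻¹' Set.Ioo 0 1)
    (hyK : y ∉ K) (hyK' : y' ∉ K) (hx : x ∈ A) (hxK : x ∈ K) (h1 : r y < r x) (h2 : r x < r y') :
    K ⊆ r ⁻¹' Set.Ioo (r y) (r y') := by
  refine (hK.subset_of_disjoint_frontier_s16 (Z := A ∩ r ⁻¹' Set.Ioo (r y) (r y')) ?_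
    ⟨x, hxK, hx, h1, h2⟩).trans Set.inter_subset_right
  rw [Set.disjoint_left]
  intro z hzK hz
  obtain ⟨hzA, hz | hz⟩ := h.frontier_Ioo_subset hy.2.1.le hy'.2.2.le hz
  · exact hyK (h.injOn hzA hy.1 hz ▸ hzK)
  · exact hyK' (h.injOn hzA hy'.1 hz ▸ hzK)

theorem finite_frontier_inter (h : IsEdgeCoordinate A r) {K : Set X} (hK : IsPreconnected K)
    (hKc : IsClosed K) : (frontier K ∩ (A ∩ r ⁻¹' Set.Ioo 0 1)).Finite := by
  set F := frontier K ∩ (A ∩ r ⁻¹' Set.Ioo 0 1) with hF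
  by_contra hinf
  have hinf' : (r '' F).Infinite :=
    Set.Infinite.image (h.injOn.mono fun z hz => hz.2.1) hinf
  obtain ⟨T, hTF, hT⟩ := hinf'.exists_subset_card_eq 3
  let e := T.orderEmbOfFin hT
  have hmem : ∀ i, e i ∈ r '' F := fun i => hTF (T.orderEmbOfFin_mem hT i)
  obtain ⟨x₁, hx₁, he₁⟩ := hmem 0
  obtain ⟨x₂, hx₂, he₂⟩ := hmem 1
  obtain ⟨x₃, hx₃, he₃⟩ := hmem 2
  have h12 : r x₁ < r x₂ := by rw [he₁, he₂]; exact e.strictMono (by decide)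
  have h23 : r x₂ < r x₃ := by rw [he₂, he₃]; exact e.strictMono (by decide)
  have hFK : F ⊆ K := fun z hz => hKc.frontier_subset hz.1
  have near : ∀ z ∈ F, ∀ s t : ℝ, s < r z → r z < t →
      ∃ y ∈ A ∩ r ⁻¹' Set.Ioo 0 1, y ∉ K ∧ s < r y ∧ r y < t := by
    intro z hz s t hs ht
    have hopen : IsOpen ((A ∩ r ⁻¹' Set.Ioo 0 1) ∩ r ⁻¹' Set.Ioo s t) :=
      h.isOpen.inter (_root_.isOpen_Ioo.preimage h.continuous)
    have hcl : z ∈ closure Kᶜ := by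
      have := hz.1
      rw [frontier_eq_closure_inter_closure] at this
      exact this.2
    obtain ⟨y, ⟨hy, hy1, hy2⟩, hyK⟩ := mem_closure_iff.1 hcl _ hopen ⟨hz.2, hs, ht⟩
    exact ⟨y, hy, hyK, hy1, hy2⟩
  obtain ⟨y₁, hy₁, hyK₁, -, hlt₁⟩ := near x₁ hx₁ (r x₁ - 1) (r x₂) (by linarith) h12
  obtain ⟨y₂, hy₂, hyK₂, hlt₂, hlt₂'⟩ := near x₂ hx₂ (r x₁) (r x₃) h12 h23
  obtain ⟨y₃, hy₃, hyK₃, hlt₃, -⟩ := near x₃ hx₃ (r x₂) (r x₃ + 1) h23 (by linarith)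
  have hne : r y₂ ≠ r x₂ := fun heq => hyK₂ (h.injOn hy₂.1 hx₂.2.1 heq ▸ hFK hx₂)
  rcases lt_or_gt_of_ne hne with hlt | hlt
  · have := h.subset_of_between hK hy₂ hy₃ hyK₂ hyK₃ hx₂.2.1 (hFK hx₂) hlt hlt₃ (hFK hx₁)
    exact absurd this.1 hlt₂.not_gt
  · have := h.subset_of_between hK hy₁ hy₂ hyK₁ hyK₂ hx₂.2.1 (hFK hx₂) hlt₁ hlt (hFK hx₃)
    exact absurd this.2 hlt₂'.not_gt

/-- A self-map of a compact connected subset of an edge has a fixed point. -/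
theorem exists_fixed_point (h : IsEdgeCoordinate A r) {L : Set X} (hL : IsConnected L)
    (hLc : IsCompact L) (hLA : L ⊆ A) {g : X → X} (hg : Continuous g) (hgL : Set.MapsTo g L L) :
    ∃ z ∈ L, g z = z := by
  obtain ⟨a, ha, hmin⟩ := hLc.exists_isMinOn hL.nonempty h.continuous.continuousOn
  obtain ⟨b, hb, hmax⟩ := hLc.exists_isMaxOn hL.nonempty h.continuous.continuousOn
  have hcont : Continuous fun z => r (g z) - r z := (h.continuous.comp hg).sub h.continuous
  obtain ⟨z, hz, hz0⟩ := hL.isPreconnected.intermediate_value hb ha hcont.continuousOn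
    (show (0 : ℝ) ∈ Set.Icc _ _ from
      ⟨sub_nonpos.2 (hmax (hgL hb)), sub_nonneg.2 (hmin (hgL ha))⟩)
  exact ⟨z, hz, h.injOn (hLA (hgL hz)) (hLA hz) (sub_eq_zero.1 hz0)⟩

end IsEdgeCoordinate

/-- A topological graph has finitely many edges with coordinates whose open parts
cover it up to finitely many points. -/
theorem IsTopGraph.exists_edgeCoordinates {G : Type*} [MetricSpace G] (hG : IsTopGraph G) :
    ∃ (n : ℕ) (A : Fin n → Set G) (r : Fin n → G → ℝ),
      (∀ i, IsEdgeCoordinate (A i) (r i)) ∧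
      (⋃ i, A i ∩ r i ⁻¹' Set.Ioo 0 1)ᶜ.Finite := by
  obtain ⟨hcpt, -, n, A, a, b, harc, hcov, hint⟩ := hG
  have hcoord : ∀ i, ∃ r : G → ℝ, Continuous r ∧ IsClosed (A i) ∧ Set.InjOn r (A i) ∧
      r (a i) = 0 ∧ r (b i) = 1 ∧ ∀ z ∈ A i, r z ∉ Set.Ioo (0 : ℝ) 1 → z = a i ∨ z = b i := by
    intro i
    obtain ⟨φ, hφ, hinj, hrange, ha, hb⟩ := harc i
    have hemb := hφ.isClosedEmbedding hinj
    obtain ⟨r, hr⟩ := ContinuousMap.exists_extension' hemb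
      (⟨Subtype.val, continuous_subtype_val⟩ : C(Set.Icc (0 : ℝ) 1, ℝ))
    have hr' : ∀ t, r (φ t) = t := fun t => congrFun hr t
    refine ⟨r, r.continuous, hrange ▸ hemb.isClosed_range, ?_, ?_, ?_, ?_⟩
    · rw [← hrange]
      rintro _ ⟨s, rfl⟩ _ ⟨t, rfl⟩ hst
      rw [hr', hr'] at hst
      rw [Subtype.ext hst]
    · rw [← ha, hr']
    · rw [← hb, hr']
    · rw [← hrange]
      rintro _ ⟨⟨t, ht0, ht1⟩, rfl⟩ ht
      rw [hr'] at ht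
      rcases ht0.eq_or_lt with h0 | h0
      · left
        rw [← ha]
        exact congrArg φ (Subtype.ext h0.symm)
      · rcases ht1.eq_or_lt with h1 | h1
        · right
          rw [← hb]
          exact congrArg φ (Subtype.ext h1)
        · exact absurd ⟨h0, h1⟩ ht
  choose r hrc hAc hinj hra hrb hend using hcoord
  refine ⟨n, A, r, fun i => ⟨hAc i, hrc i, hinj i, ?_⟩, ?_⟩
  · have hclosed : IsClosed ((r i ⁻¹' Set.Ioo 0 1)ᶜ ∪ ⋃ j ∈ {j | j ≠ i}, A j) :=
      by
      refine (isOpen_Ioo.preimage (hrc i)).isClosed_compl.union ?_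
      exact (Set.toFinite {j | j ≠ i}).isClosed_biUnion fun j _ => hAc j
    convert hclosed.isOpen_compl using 1
    ext z
    simp only [Set.mem_inter_iff, Set.compl_union, compl_compl, Set.mem_compl_iff,
      Set.mem_iUnion, Set.mem_ofPred_eq, exists_prop, not_exists, not_and]
    constructor
    · rintro ⟨hzA, hz⟩
      refine ⟨hz, fun j hj hzj => ?_⟩
      rcases hint i j hj.symm with h | ⟨p, hp, hpi, -⟩
      · exact Set.eq_empty_iff_forall_notMem.1 h z ⟨hzA, hzj⟩
      · have hzp : z = p := by
          have : z ∈ A i ∩ A j := ⟨hzA, hzj⟩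
          rwa [hp] at this
        rw [← hzp] at hpi
        rcases hpi with rfl | hpi
        · exact absurd hz.1 (by rw [hra]; exact lt_irrefl _)
        · rw [Set.mem_singleton_iff.1 hpi] at hz
          exact absurd hz.2 (by rw [hrb]; exact lt_irrefl _)
    · rintro ⟨hz, hz'⟩
      refine ⟨?_, hz⟩
      obtain ⟨j, hj⟩ := Set.mem_iUnion.1 (hcov ▸ Set.mem_univ z)
      by_cases hji : j = i
      · exact hji ▸ hj
      · exact absurd hj (hz' j hji)
  · refine (Set.finite_iUnion fun i => Set.toFinite {a i, b i}).subset fun z hz => ?_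
    obtain ⟨i, hi⟩ := Set.mem_iUnion.1 (hcov ▸ Set.mem_univ z)
    refine Set.mem_iUnion.2 ⟨i, hend i z hi fun h => hz ?_⟩
    exact Set.mem_iUnion.2 ⟨i, hi, h⟩

theorem IsTopGraph.finite_frontier {G : Type*} [MetricSpace G] (hG : IsTopGraph G)
    {K : Set G} (hK : IsPreconnected K) (hKc : IsClosed K) : (frontier K).Finite := by
  obtain ⟨n, A, r, hA, hfin⟩ := hG.exists_edgeCoordinates
  refine (hfin.union (Set.finite_iUnion fun i => (hA i).finite_frontier_inter hK hKc)).subset ?_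
  intro z hz
  by_cases h : z ∈ ⋃ i, A i ∩ r i ⁻¹' Set.Ioo 0 1
  · obtain ⟨i, hi⟩ := Set.mem_iUnion.1 h
    exact Or.inr (Set.mem_iUnion.2 ⟨i, hz, hi⟩)
  · exact Or.inl h

/-- Outside a suitable finite set, compact connected subsets of a graph have the fixed point
property for maps of the graph. -/
theorem IsTopGraph.exists_finite_fixed_point {G : Type*} [MetricSpace G] (hG : IsTopGraph G) :
    ∃ B : Set G, B.Finite ∧ ∀ L : Set G, IsConnected L → IsCompact L → Disjoint L B →
      ∀ g : G → G, Continuous g → Set.MapsTo g L L → ∃ z ∈ L, g z = z := by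
  obtain ⟨n, A, r, hA, hfin⟩ := hG.exists_edgeCoordinates
  refine ⟨_, hfin.union (Set.finite_iUnion fun i => (hA i).finite_frontier_unit), ?_⟩
  intro L hL hLc hLB g hg hgL
  rw [Set.disjoint_union_right, Set.disjoint_iUnion_right] at hLB
  obtain ⟨z, hz⟩ := hL.nonempty
  obtain ⟨i, hi⟩ := Set.mem_iUnion.1 (Set.notMem_compl_iff.1 (hLB.1.notMem_of_mem_left hz))
  have hLA := hL.isPreconnected.subset_of_disjoint_frontier_s16 (hLB.2 i) ⟨z, hz, hi⟩
  exact (hA i).exists_fixed_point hL hLc (hLA.trans Set.inter_subset_left) hg hgL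

theorem mapsTo_omegaSet {G : Type*} [TopologicalSpace G] {f : G → G} (hf : Continuous f) (x : G) :
    Set.MapsTo f (omegaSet f x) (omegaSet f x) := by
  intro w hw
  refine Set.mem_iInter.2 fun n => ?_
  refine map_mem_closure hf (Set.mem_iInter.1 hw n) ?_
  rintro _ ⟨m, hm, rfl⟩
  exact ⟨m + 1, Nat.le_succ_of_le hm, Function.iterate_succ_apply' f m x⟩

theorem Set.Finite.exists_disjoint_of_pairwise {X : Type*} {B : Set X} (hB : B.Finite) {k : ℕ}
    (hk : hB.toFinset.card < k) {L : ℕ → Set X}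
    (hL : ∀ i j, i < k → j < k → i ≠ j → Disjoint (L i) (L j)) :
    ∃ i < k, Disjoint (L i) B := by
  by_contra! hcon
  have hcon' : ∀ i, ∃ z, i < k → z ∈ L i ∧ z ∈ B := by
    intro i
    by_cases hi : i < k
    · obtain ⟨z, hz⟩ := Set.not_disjoint_iff.1 (hcon i hi)
      exact ⟨z, fun _ => hz⟩
    · have hk0 : 0 < k := (Nat.zero_le _).trans_lt hk
      obtain ⟨z, -⟩ := Set.not_disjoint_iff.1 (hcon 0 hk0)
      exact ⟨z, fun h => absurd h hi⟩
  choose z hz using hcon'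
  obtain ⟨i, hi, j, hj, hij, heq⟩ := Finset.exists_ne_map_eq_of_card_lt_of_maps_to
    (s := Finset.range k) (t := hB.toFinset) (by simpa using hk) (f := z)
    (fun i hi => by simpa using (hz i (by simpa using hi)).2)
  have hi' := Finset.mem_range.1 hi
  have hj' := Finset.mem_range.1 hj
  exact (hL i j hi' hj' hij).notMem_of_mem_left (hz i hi').1 (heq ▸ (hz j hj').1)

theorem Set.image_iterate_image_iterate {G : Type*} (f : G → G) (K : Set G) (m i : ℕ) :
    f^[m] '' (f^[i] '' K) = f^[m + i] '' K := by
  rw [Function.iterate_add, Set.image_comp]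

namespace IsPeriodicSubgraph

variable {G : Type*} [MetricSpace G] {f : G → G} {K : Set G} {k : ℕ}

theorem isCompact_image [CompactSpace G] (hf : Continuous f) (hK : IsPeriodicSubgraph f K k)
    (i : ℕ) : IsCompact (f^[i] '' K) :=
  hK.1.1.isCompact.image (hf.iterate i)

theorem isConnected_image_s16 (hf : Continuous f) (hK : IsPeriodicSubgraph f K k) (i : ℕ) :
    IsConnected (f^[i] '' K) :=
  hK.1.2.1.image _ (hf.iterate i).continuousOn

theorem image_add_period (hK : IsPeriodicSubgraph f K k) (i : ℕ) :
    f^[i + k] '' K = f^[i] '' K := by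
  rw [← Set.image_iterate_image_iterate, hK.2.2.1]

theorem mapsTo_image (hK : IsPeriodicSubgraph f K k) {i j : ℕ} (hi : i < k) :
    Set.MapsTo f^[k - i + j] (f^[i] '' K) (f^[j] '' K) := by
  rw [Set.mapsTo_iff_image_subset, Set.image_iterate_image_iterate,
    show k - i + j + i = j + k by omega, hK.image_add_period]

end IsPeriodicSubgraph

theorem IsCycleOfGraphs.mapsTo {G : Type*} [MetricSpace G] {f : G → G} {Z : Set G} {k : ℕ}
    (hZ : IsCycleOfGraphs f Z k) : Set.MapsTo f Z Z := by
  obtain ⟨K, hK, rfl⟩ := hZ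
  intro z hz
  simp only [Set.mem_iUnion, Finset.mem_range, exists_prop] at hz ⊢
  obtain ⟨i, hi, hz⟩ := hz
  have hfz : f z ∈ f^[1 + i] '' K := by
    rw [← Set.image_iterate_image_iterate]
    exact ⟨z, hz, rfl⟩
  rcases Nat.lt_or_ge (1 + i) k with h | h
  · exact ⟨1 + i, h, hfz⟩
  · refine ⟨0, hK.2.1, ?_⟩
    rwa [show 1 + i = 0 + k by omega, hK.image_add_period] at hfz

theorem IsCycleOfGraphs.isClosed {G : Type*} [MetricSpace G] [CompactSpace G] {f : G → G}
    (hf : Continuous f) {Z : Set G} {k : ℕ} (hZ : IsCycleOfGraphs f Z k) : IsClosed Z := by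
  obtain ⟨K, hK, rfl⟩ := hZ
  exact (Finset.range k).finite_toSet.isClosed_biUnion fun i _ => (hK.isCompact_image hf i).isClosed

theorem IsCycleOfGraphs.finite_frontier {G : Type*} [MetricSpace G] [CompactSpace G]
    (hG : IsTopGraph G) {f : G → G} (hf : Continuous f) {Z : Set G} {k : ℕ}
    (hZ : IsCycleOfGraphs f Z k) : (frontier Z).Finite := by
  have hcl := hZ.isClosed hf
  obtain ⟨K, hK, rfl⟩ := hZ
  refine ((Finset.range k).finite_toSet.biUnion fun i _ => hG.finite_frontier
    (hK.isConnected_image_s16 hf i).isPreconnected (hK.isCompact_image hf i).isClosed).subset ?_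
  intro z hz
  have hzZ := hcl.frontier_subset hz
  simp only [Set.mem_iUnion, exists_prop] at hzZ
  obtain ⟨i, hi, hzi⟩ := hzZ
  refine Set.mem_biUnion hi ⟨subset_closure hzi, fun hint => hz.2 ?_⟩
  exact interior_mono (Set.subset_biUnion_of_mem (u := fun i => f^[i] '' K) hi) hint

/-- Cycles of sufficiently large period containing a forward invariant set lie in any given
cycle containing it. -/
theorem IsCycleOfGraphs.exists_subset_of_period {G : Type*} [MetricSpace G] (hG : IsTopGraph G)
    {f : G → G} (hf : Continuous f) {W : Set G} (hW : W.Nonempty) (hfW : Set.MapsTo f W W)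
    {Z : Set G} {k : ℕ} (hZ : IsCycleOfGraphs f Z k) (hWZ : W ⊆ Z) :
    ∃ N, ∀ Z' k', N < k' → IsCycleOfGraphs f Z' k' → W ⊆ Z' → Z' ⊆ Z := by
  have := hG.1
  have hfin := hZ.finite_frontier hG hf
  refine ⟨hfin.toFinset.card, ?_⟩
  rintro Z' k' hk' ⟨L, hL, rfl⟩ hWL
  obtain ⟨i, hi, hdisj⟩ := hfin.exists_disjoint_of_pairwise hk' hL.2.2.2
  obtain ⟨w, hw⟩ := hW
  have hwL := hWL hw
  simp only [Set.mem_iUnion, Finset.mem_range, exists_prop] at hwL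
  obtain ⟨j, hj, hwj⟩ := hwL
  have hLi : f^[i] '' L ⊆ Z :=
    (hL.isConnected_image_s16 hf i).isPreconnected.subset_of_disjoint_frontier_s16 hdisj
      ⟨_, hL.mapsTo_image hj hwj, hWZ (hfW.iterate _ hw)⟩
  refine Set.iUnion₂_subset fun m _ => ?_
  have himg : f^[m] '' L = f^[k' - i + m] '' (f^[i] '' L) := by
    rw [Set.image_iterate_image_iterate, show k' - i + m + i = m + k' by omega,
      hL.image_add_period]
  rw [himg]
  exact (Set.image_mono hLi).trans (hZ.mapsTo.iterate _).image_subset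

/-- Every component of a cycle of sufficiently large period contains a periodic point. -/
theorem IsTopGraph.exists_perPts_of_period {G : Type*} [MetricSpace G] (hG : IsTopGraph G)
    {f : G → G} (hf : Continuous f) :
    ∃ N, ∀ Z k, N < k → IsCycleOfGraphs f Z k → ∀ p ∈ Z,
      (connectedComponentIn Z p ∩ PerPts f).Nonempty := by
  have := hG.1
  obtain ⟨B, hB, hfix⟩ := hG.exists_finite_fixed_point
  refine ⟨hB.toFinset.card, ?_⟩
  rintro Z k hk ⟨L, hL, rfl⟩ p hp
  obtain ⟨i, hi, hdisj⟩ := hB.exists_disjoint_of_pairwise hk hL.2.2.2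
  have hmaps : Set.MapsTo f^[k] (f^[i] '' L) (f^[i] '' L) := by
    simpa [Nat.sub_add_cancel hi.le] using hL.mapsTo_image (j := i) hi
  obtain ⟨z, hz, hzk⟩ := hfix _ (hL.isConnected_image_s16 hf i) (hL.isCompact_image hf i) hdisj
    _ (hf.iterate k) hmaps
  have hp' := hp
  simp only [Set.mem_iUnion, Finset.mem_range, exists_prop] at hp'
  obtain ⟨j, hj, hpj⟩ := hp'
  have hsub : f^[j] '' L ⊆ ⋃ i ∈ Finset.range k, f^[i] '' L :=
    Set.subset_biUnion_of_mem (u := fun i => f^[i] '' L) (Finset.mem_range.2 hj)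
  refine ⟨f^[k - i + j] z, (hL.isConnected_image_s16 hf j).isPreconnected.subset_connectedComponentIn
    hpj hsub (hL.mapsTo_image hi hz), k, hL.2.1, ?_⟩
  rw [← Function.iterate_add_apply, Nat.add_comm, Function.iterate_add_apply, hzk]

theorem IsClosed.isClosed_connectedComponentIn {X : Type*} [TopologicalSpace X] {F : Set X}
    (hF : IsClosed F) (x : X) : IsClosed (connectedComponentIn F x) := by
  by_cases hx : x ∈ F
  · refine isClosed_of_closure_subset ?_
    exact isPreconnected_connectedComponentIn.closure.subset_connectedComponentIn
      (subset_closure (mem_connectedComponentIn hx))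
      (closure_minimal (connectedComponentIn_subset F x) hF)
  · rw [connectedComponentIn_eq_empty hx]
    exact isClosed_empty

/-- If `ω_f(x)` is a solenoid, then every connected component of `P(x)`, the
intersection of all cycles of graphs containing `ω_f(x)`, contains a point of the
closure of the set of periodic points of `f`. -/
theorem component_of_P_meets_closure_perPts {G : Type*} [MetricSpace G]
    (hG : IsTopGraph G) (f : G → G) (hf : Continuous f) (x : G)
    (hsol : IsSolenoid f (omegaSet f x)) :
    ∀ p ∈ ⋂₀ {Z : Set G | ∃ k, IsCycleOfGraphs f Z k ∧ omegaSet f x ⊆ Z},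
      (connectedComponentIn
          (⋂₀ {Z : Set G | ∃ k, IsCycleOfGraphs f Z k ∧ omegaSet f x ⊆ Z}) p ∩
        closure (PerPts f)).Nonempty := by
  have := hG.1
  obtain ⟨hinf, hper⟩ := hsol
  have hfW := mapsTo_omegaSet hf x
  set S : Set (Set G) := {Z | ∃ k, IsCycleOfGraphs f Z k ∧ omegaSet f x ⊆ Z} with hS
  intro p hp
  obtain ⟨N₀, hN₀⟩ := hG.exists_perPts_of_period hf
  have hrefine : ∀ Z ∈ S, ∀ Z' ∈ S, ∃ Y ∈ S, Y ⊆ Z ∧ Y ⊆ Z' ∧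
      (connectedComponentIn Y p ∩ PerPts f).Nonempty := by
    rintro Z ⟨k, hZ, hWZ⟩ Z' ⟨k', hZ', hWZ'⟩
    obtain ⟨N₁, hN₁⟩ := hZ.exists_subset_of_period hG hf hinf.nonempty hfW hWZ
    obtain ⟨N₂, hN₂⟩ := hZ'.exists_subset_of_period hG hf hinf.nonempty hfW hWZ'
    obtain ⟨Y, m, hm, hY, hWY⟩ := hper (N₀ + N₁ + N₂ + 1)
    have hYS : Y ∈ S := ⟨m, hY, hWY⟩
    exact ⟨Y, hYS, hN₁ Y m (by omega) hY hWY, hN₂ Y m (by omega) hY hWY,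
      hN₀ Y m (by omega) hY p (Set.mem_sInter.1 hp Y hYS)⟩
  have hclosed : ∀ Z : S, IsClosed (connectedComponentIn (Z : Set G) p) := by
    rintro ⟨Z, k, hZ, -⟩
    exact (hZ.isClosed hf).isClosed_connectedComponentIn p
  have hdir : Directed (· ⊇ ·) fun Z : S => connectedComponentIn (Z : Set G) p := by
    rintro ⟨Z, hZ⟩ ⟨Z', hZ'⟩
    obtain ⟨Y, hY, h1, h2, -⟩ := hrefine Z hZ Z' hZ'
    exact ⟨⟨Y, hY⟩, connectedComponentIn_mono p h1, connectedComponentIn_mono p h2⟩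
  have hne : Nonempty S := by
    obtain ⟨Y, m, -, hY, hWY⟩ := hper 0
    exact ⟨⟨Y, m, hY, hWY⟩⟩
  have hconn := isPreconnected_iInter_of_directed hdir (fun Z => (hclosed Z).isCompact)
    fun Z => isPreconnected_connectedComponentIn
  have hsub : (⋂ Z : S, connectedComponentIn (Z : Set G) p) ⊆ connectedComponentIn (⋂₀ S) p := by
    refine hconn.subset_connectedComponentIn (Set.mem_iInter.2 fun Z => ?_) ?_
    · exact mem_connectedComponentIn (Set.mem_sInter.1 hp Z Z.2)
    · rw [Set.sInter_eq_iInter]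
      exact Set.iInter_mono fun Z => connectedComponentIn_subset _ _
  have hcl : ∀ Z : S, IsClosed (connectedComponentIn (Z : Set G) p ∩ closure (PerPts f)) :=
    fun Z => (hclosed Z).inter isClosed_closure
  obtain ⟨q, hq⟩ := IsCompact.nonempty_iInter_of_directed_nonempty_isCompact_isClosed
    (fun Z : S => connectedComponentIn (Z : Set G) p ∩ closure (PerPts f))
    (fun Z Z' => (hdir Z Z').imp fun Y h =>
      ⟨Set.inter_subset_inter_left _ h.1, Set.inter_subset_inter_left _ h.2⟩)
    (fun Z => by
      obtain ⟨Y, -, hYZ, -, hY⟩ := hrefine Z Z.2 Z Z.2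
      exact hY.mono (Set.inter_subset_inter (connectedComponentIn_mono p hYZ) subset_closure))
    (fun Z => (hcl Z).isCompact) hcl
  rw [Set.mem_iInter] at hq
  exact ⟨q, hsub (Set.mem_iInter.2 fun Z => (hq Z).1), (hq hne.some).2⟩
end
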